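/- arXiv:1311.4685 — 5 statements merged into one kernel-verified Lean document; each statement's English description precedes it below -/
import Mathlib

section
/- (Lindenstrauss–Pełczyński type theorem) Let 1 ≤ p ≤ 2 and 2 < q < ∞, let m be a positive integer, let X be a Banach space and let Y be a closed subspace of an L_{p,λ}-space for some λ > 1. Then an m-homogeneous polynomial P : X → Y is factorable strongly q-summing if and only if it is factorable strongly 2-summing, i.e., P_{FSt,q}(^m X; Y) = P_{FSt,2}(^m X; Y). -/
open scoped BigOperators
open MeasureTheory

noncomputable section

section Defs

variable (𝕜 : Type*) [RCLike 𝕜]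

section Multi

variable {n : ℕ} {X : Fin n → Type*} {Y : Type*}
  [∀ k, NormedAddCommGroup (X k)] [∀ k, NormedSpace 𝕜 (X k)]
  [NormedAddCommGroup Y] [NormedSpace 𝕜 Y]

/-- `C` witnesses the defining inequality of factorable strongly `p`-summing
multilinear operators. -/
def FactStronglySummingBound (p : ℝ) (T : ContinuousMultilinearMap 𝕜 X Y) (C : ℝ) : Prop :=
  0 ≤ C ∧ ∀ (m₁ m₂ : ℕ) (x : Fin m₁ → Fin m₂ → (∀ k, X k)) (lam : Fin m₁ → Fin m₂ → 𝕜),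
    (∑ j, ‖∑ i, lam j i • T (x j i)‖ ^ p) ^ (1 / p) ≤
      C * ⨆ φ : {φ : ContinuousMultilinearMap 𝕜 X 𝕜 // ‖φ‖ ≤ 1},
        (∑ j, ‖∑ i, lam j i • φ.1 (x j i)‖ ^ p) ^ (1 / p)

/-- Factorable strongly `p`-summing continuous multilinear operators. -/
def FactStronglySumming (p : ℝ) (T : ContinuousMultilinearMap 𝕜 X Y) : Prop :=
  ∃ C, FactStronglySummingBound 𝕜 p T C

/-- The factorable strongly `p`-summing norm `‖T‖_{FSt,p}` (the least admissible constant). -/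
def fstMultiNorm (p : ℝ) (T : ContinuousMultilinearMap 𝕜 X Y) : ℝ :=
  sInf {C | FactStronglySummingBound 𝕜 p T C}

/-- Strongly `p`-summing continuous multilinear operators (Dimant). -/
def StronglySumming (p : ℝ) (T : ContinuousMultilinearMap 𝕜 X Y) : Prop :=
  ∃ C : ℝ, 0 ≤ C ∧ ∀ (m : ℕ) (x : Fin m → (∀ k, X k)),
    (∑ j, ‖T (x j)‖ ^ p) ^ (1 / p) ≤
      C * ⨆ φ : {φ : ContinuousMultilinearMap 𝕜 X 𝕜 // ‖φ‖ ≤ 1},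
        (∑ j, ‖φ.1 (x j)‖ ^ p) ^ (1 / p)

/-- Factorable `p`-dominated continuous multilinear operators. -/
def FactorablePDominated (p : ℝ) (T : ContinuousMultilinearMap 𝕜 X Y) : Prop :=
  ∃ C : ℝ, 0 ≤ C ∧ ∀ (m₁ m₂ : ℕ) (x : Fin m₁ → Fin m₂ → (∀ k, X k))
    (lam : Fin m₁ → Fin m₂ → 𝕜),
    (∑ j, ‖∑ i, lam j i • T (x j i)‖ ^ p) ^ (1 / p) ≤
      C * ⨆ φ : ∀ k, {f : X k →L[𝕜] 𝕜 // ‖f‖ ≤ 1},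
        (∑ j, ‖∑ i, lam j i • ∏ k, (φ k).1 (x j i k)‖ ^ p) ^ (1 / p)

/-- `p`-semi-integral continuous multilinear operators. -/
def PSemiIntegral (p : ℝ) (T : ContinuousMultilinearMap 𝕜 X Y) : Prop :=
  ∃ C : ℝ, 0 ≤ C ∧ ∀ (m : ℕ) (x : Fin m → (∀ k, X k)),
    (∑ j, ‖T (x j)‖ ^ p) ^ (1 / p) ≤
      C * ⨆ φ : ∀ k, {f : X k →L[𝕜] 𝕜 // ‖f‖ ≤ 1},
        (∑ j, ‖∏ k, (φ k).1 (x j k)‖ ^ p) ^ (1 / p)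

end Multi

section Poly

variable {X Y : Type*} [NormedAddCommGroup X] [NormedSpace 𝕜 X]
  [NormedAddCommGroup Y] [NormedSpace 𝕜 Y]

/-- `P` is a continuous `m`-homogeneous polynomial: the diagonal of a continuous
`m`-linear map. -/
def IsHomogPoly (m : ℕ) (P : X → Y) : Prop :=
  ∃ T : ContinuousMultilinearMap 𝕜 (fun _ : Fin m => X) Y, ∀ x, P x = T (fun _ => x)

/-- Sup norm of a (homogeneous polynomial) map on the closed unit ball. -/
def polyNorm (P : X → Y) : ℝ :=
  ⨆ x : {x : X // ‖x‖ ≤ 1}, ‖P x.1‖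

/-- `C` witnesses the defining inequality of factorable strongly `p`-summing
`m`-homogeneous polynomials. -/
def FactStronglySummingPolyBound (m : ℕ) (p : ℝ) (P : X → Y) (C : ℝ) : Prop :=
  0 ≤ C ∧ ∀ (m₁ m₂ : ℕ) (x : Fin m₁ → Fin m₂ → X) (lam : Fin m₁ → Fin m₂ → 𝕜),
    (∑ j, ‖∑ i, lam j i • P (x j i)‖ ^ p) ^ (1 / p) ≤
      C * ⨆ q : {q : X → 𝕜 // IsHomogPoly 𝕜 m q ∧ polyNorm q ≤ 1},
        (∑ j, ‖∑ i, lam j i • q.1 (x j i)‖ ^ p) ^ (1 / p)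

/-- Factorable strongly `p`-summing `m`-homogeneous polynomials. -/
def FactStronglySummingPoly (m : ℕ) (p : ℝ) (P : X → Y) : Prop :=
  IsHomogPoly 𝕜 m P ∧ ∃ C, FactStronglySummingPolyBound 𝕜 m p P C

/-- The factorable strongly `p`-summing norm `‖P‖_{FSt,p}` of a polynomial. -/
def fstPolyNorm (m : ℕ) (p : ℝ) (P : X → Y) : ℝ :=
  sInf {C | FactStronglySummingPolyBound 𝕜 m p P C}

/-- `C` witnesses the defining inequality of absolutely `p`-summing linear operators. -/
def AbsSummingBound (p : ℝ) (u : X →L[𝕜] Y) (C : ℝ) : Prop :=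
  0 ≤ C ∧ ∀ (m : ℕ) (x : Fin m → X),
    (∑ j, ‖u (x j)‖ ^ p) ^ (1 / p) ≤
      C * ⨆ φ : {φ : X →L[𝕜] 𝕜 // ‖φ‖ ≤ 1}, (∑ j, ‖φ.1 (x j)‖ ^ p) ^ (1 / p)

/-- Absolutely `p`-summing continuous linear operators. -/
def AbsolutelySumming (p : ℝ) (u : X →L[𝕜] Y) : Prop :=
  ∃ C, AbsSummingBound 𝕜 p u C

/-- The absolutely `p`-summing norm `π_p(u)` (the least admissible constant). -/
def piSummingNorm (p : ℝ) (u : X →L[𝕜] Y) : ℝ :=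
  sInf {C | AbsSummingBound 𝕜 p u C}

end Poly

end Defs

end
open scoped ENNReal

/-- `Z` is an `L_{p,λ}`-space: every finite-dimensional subspace `E` of `Z` is contained
in a finite-dimensional subspace `F` of `Z` admitting an isomorphism
`v : F → ℓ_p^{dim F}` with `‖v‖·‖v⁻¹‖ < λ`. (Here `1 ≤ p < ∞`.) -/
def IsLpLambdaSpace (𝕜 : Type*) [RCLike 𝕜] (p lam : ℝ) (hp : 1 ≤ p) (Z : Type*)
    [NormedAddCommGroup Z] [NormedSpace 𝕜 Z] : Prop :=
  haveI : Fact ((1 : ℝ≥0∞) ≤ ENNReal.ofReal p) := ⟨ENNReal.one_le_ofReal.mpr hp⟩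
  ∀ E : Submodule 𝕜 Z, FiniteDimensional 𝕜 E →
    ∃ F : Submodule 𝕜 Z, E ≤ F ∧ FiniteDimensional 𝕜 F ∧
      ∃ v : F ≃L[𝕜] PiLp (ENNReal.ofReal p) (fun _ : Fin (Module.finrank 𝕜 F) => 𝕜),
        ‖(v : F →L[𝕜] PiLp (ENNReal.ofReal p) (fun _ : Fin (Module.finrank 𝕜 F) => 𝕜))‖ *
          ‖(v.symm :
              PiLp (ENNReal.ofReal p) (fun _ : Fin (Module.finrank 𝕜 F) => 𝕜) →L[𝕜] F)‖
          < lam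


/-- sign of a Boolean -/
def lpSgn (b : Bool) : ℝ := if b then 1 else -1

lemma lp_exp_avg (n : ℕ) (a : Fin n → ℝ) :
    ∑ e : Fin n → Bool, Real.exp (∑ k, lpSgn (e k) * a k)
      ≤ 2 ^ n * Real.exp ((∑ k, a k ^ 2) / 2) := by
  have h1 : ∀ e : Fin n → Bool, Real.exp (∑ k, lpSgn (e k) * a k)
      = ∏ k, Real.exp (lpSgn (e k) * a k) := fun e => Real.exp_sum _ _
  simp_rw [h1]
  have h2 := Finset.prod_univ_sum (fun _ : Fin n => (Finset.univ : Finset Bool))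
    (fun k b => Real.exp (lpSgn b * a k))
  rw [Fintype.piFinset_univ] at h2
  rw [← h2, Finset.sum_div, Real.exp_sum]
  have h3 : (2:ℝ) ^ n = ∏ _k : Fin n, (2:ℝ) := by simp
  rw [h3, ← Finset.prod_mul_distrib]
  apply Finset.prod_le_prod
  · intro i _; positivity
  · intro i _
    have := Real.cosh_le_exp_half_sq (a i)
    rw [Real.cosh_eq] at this
    simp [lpSgn]
    linarith

lemma lp_rpow_le_exp (r : ℝ) (hr : 0 ≤ r) :
    ∃ K : ℝ, 0 ≤ K ∧ ∀ t : ℝ, |t| ^ r ≤ K * (Real.exp t + Real.exp (-t)) := by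
  obtain ⟨N, hN⟩ := exists_nat_ge r
  refine ⟨1 + N.factorial, by positivity, fun t => ?_⟩
  have hE : Real.exp |t| ≤ Real.exp t + Real.exp (-t) := by
    rcases abs_cases t with ⟨h, _⟩ | ⟨h, _⟩ <;> rw [h] <;>
      linarith [Real.exp_pos t, Real.exp_pos (-t)]
  have h1 : (1:ℝ) ≤ Real.exp |t| := Real.one_le_exp (abs_nonneg t)
  have h2 : |t| ^ N ≤ N.factorial * Real.exp |t| := by
    have := Real.pow_div_factorial_le_exp |t| (abs_nonneg t) N
    rw [div_le_iff₀ (by positivity)] at this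
    linarith
  have h3 : |t| ^ r ≤ 1 + |t| ^ N := by
    rcases le_total |t| 1 with h | h
    · have := Real.rpow_le_one (abs_nonneg t) h hr
      have : 0 ≤ |t| ^ N := by positivity
      linarith
    · have := Real.rpow_le_rpow_of_exponent_le h hN
      rw [Real.rpow_natCast] at this
      linarith
  have h4 : (1 + (N.factorial:ℝ)) * Real.exp |t| ≤
    (1 + (N.factorial:ℝ)) * (Real.exp t + Real.exp (-t)) := by gcongr
  nlinarith

lemma lp_khin_real (r : ℝ) (hr : 0 < r) :
    ∃ K : ℝ, 0 ≤ K ∧ ∀ (n : ℕ) (a : Fin n → ℝ),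
      ∑ e : Fin n → Bool, |∑ k, lpSgn (e k) * a k| ^ r
        ≤ K * 2 ^ n * (∑ k, a k ^ 2) ^ (r / 2) := by
  obtain ⟨K, hK, h⟩ := lp_rpow_le_exp r hr.le
  refine ⟨K * (2 * Real.exp (1/2)), by positivity, fun n a => ?_⟩
  have hS : 0 ≤ ∑ k, a k ^ 2 := Finset.sum_nonneg fun _ _ => sq_nonneg _
  rcases hS.eq_or_lt with h0 | hpos
  · have ha : ∀ k, a k = 0 := by
      intro k
      have := (Finset.sum_eq_zero_iff_of_nonneg (fun k _ => sq_nonneg (a k))).1 h0.symm k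
        (Finset.mem_univ k)
      exact pow_eq_zero_iff (two_ne_zero) |>.1 this
    simp [ha, Real.zero_rpow hr.ne', Real.zero_rpow (half_pos hr).ne']
  · set S := ∑ k, a k ^ 2 with hSdef
    have hs : 0 < √S := Real.sqrt_pos.2 hpos
    set b : Fin n → ℝ := fun k => a k / √S with hb
    have hbS : ∑ k, b k ^ 2 = 1 := by
      simp only [hb, div_pow, ← Finset.sum_div, Real.sq_sqrt hS]
      exact div_self hpos.ne'
    have hab : ∀ e : Fin n → Bool, ∑ k, lpSgn (e k) * a k = √S * ∑ k, lpSgn (e k) * b k := by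
      intro e
      rw [Finset.mul_sum]
      refine Finset.sum_congr rfl fun k _ => ?_
      simp only [hb]; field_simp
    have hpw : √S ^ r = S ^ (r/2) := by
      rw [Real.sqrt_eq_rpow, ← Real.rpow_mul hS]; congr 1; ring
    have e1 := lp_exp_avg n b
    have e2 := lp_exp_avg n (fun k => - b k)
    simp only [mul_neg, Finset.sum_neg_distrib, neg_sq, hbS] at e1 e2
    calc ∑ e : Fin n → Bool, |∑ k, lpSgn (e k) * a k| ^ r
        = S ^ (r/2) * ∑ e : Fin n → Bool, |∑ k, lpSgn (e k) * b k| ^ r := by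
          rw [Finset.mul_sum]
          refine Finset.sum_congr rfl fun e _ => ?_
          rw [hab, abs_mul, abs_of_pos hs, Real.mul_rpow hs.le (abs_nonneg _), hpw]
      _ ≤ S ^ (r/2) * (K * (2 * (2 ^ n * Real.exp (1/2)))) := by
          refine mul_le_mul_of_nonneg_left ?_ (by positivity)
          refine (Finset.sum_le_sum fun e _ => h _).trans ?_
          rw [← Finset.mul_sum, Finset.sum_add_distrib]
          refine mul_le_mul_of_nonneg_left ?_ hK
          linarith
      _ = _ := by ring

lemma lp_khin_upper (𝕜 : Type*) [RCLike 𝕜] (r : ℝ) (hr : 0 < r) :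
    ∃ K : ℝ, 0 ≤ K ∧ ∀ (n : ℕ) (a : Fin n → 𝕜),
      ∑ e : Fin n → Bool, ‖∑ k, (lpSgn (e k) : 𝕜) * a k‖ ^ r
        ≤ K * 2 ^ n * (∑ k, ‖a k‖ ^ 2) ^ (r / 2) := by
  obtain ⟨K, hK, h⟩ := lp_khin_real r hr
  refine ⟨2 ^ r * (K + K), by positivity, fun n a => ?_⟩
  have hre : ∀ x y : ℝ, (x:ℝ) ≤ y → 0 ≤ x → x ^ (r/2) ≤ y ^ (r/2) := fun x y hxy hx =>
    Real.rpow_le_rpow hx hxy (by positivity)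
  have h1 := h n (fun k => RCLike.re (a k))
  have h2 := h n (fun k => RCLike.im (a k))
  have g1 : (∑ k, (RCLike.re (a k)) ^ 2) ^ (r/2) ≤ (∑ k, ‖a k‖ ^ 2) ^ (r / 2) := by
    apply hre _ _ _ (Finset.sum_nonneg fun _ _ => sq_nonneg _)
    refine Finset.sum_le_sum fun k _ => ?_
    rw [← sq_abs]
    exact pow_le_pow_left₀ (abs_nonneg _) (RCLike.abs_re_le_norm _) 2
  have g2 : (∑ k, (RCLike.im (a k)) ^ 2) ^ (r/2) ≤ (∑ k, ‖a k‖ ^ 2) ^ (r / 2) := by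
    apply hre _ _ _ (Finset.sum_nonneg fun _ _ => sq_nonneg _)
    refine Finset.sum_le_sum fun k _ => ?_
    rw [← sq_abs]
    exact pow_le_pow_left₀ (abs_nonneg _) (RCLike.abs_im_le_norm _) 2
  have key : ∀ z : 𝕜, ‖z‖ ^ r ≤ 2 ^ r * (|RCLike.re z| ^ r + |RCLike.im z| ^ r) := by
    intro z
    have hz : ‖z‖ ≤ 2 * max |RCLike.re z| |RCLike.im z| := by
      have : ‖z‖ ≤ |RCLike.re z| + |RCLike.im z| := by
        conv_lhs => rw [← RCLike.re_add_im z]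
        refine (norm_add_le _ _).trans ?_
        rw [norm_mul, RCLike.norm_ofReal, RCLike.norm_ofReal]
        have : ‖(RCLike.I : 𝕜)‖ ≤ 1 := by
          rcases RCLike.I_eq_zero_or_im_I_eq_one (K := 𝕜) with h | h
          · rw [h]; simp
          · exact (RCLike.norm_I_of_ne_zero (fun h0 => by rw [h0] at h; simp at h)).le
        nlinarith [abs_nonneg (RCLike.im z)]
      have := le_max_left |RCLike.re z| |RCLike.im z|
      have := le_max_right |RCLike.re z| |RCLike.im z|
      linarith
    refine (Real.rpow_le_rpow (norm_nonneg _) hz hr.le).trans ?_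
    rw [Real.mul_rpow (by norm_num) (by positivity)]
    refine mul_le_mul_of_nonneg_left ?_ (by positivity)
    have p1 : 0 ≤ |RCLike.re z| ^ r := by positivity
    have p2 : 0 ≤ |RCLike.im z| ^ r := by positivity
    rcases max_cases |RCLike.re z| |RCLike.im z| with ⟨h, _⟩ | ⟨h, _⟩ <;> rw [h] <;> linarith
  calc _ ≤ ∑ e : Fin n → Bool, 2 ^ r * (|∑ k, lpSgn (e k) * RCLike.re (a k)| ^ r
          + |∑ k, lpSgn (e k) * RCLike.im (a k)| ^ r) := by
        refine Finset.sum_le_sum fun e _ => (key _).trans ?_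
        simp only [map_sum, RCLike.re_ofReal_mul, RCLike.im_ofReal_mul]
        exact le_rfl
    _ ≤ 2 ^ r * (K * 2 ^ n * (∑ k, ‖a k‖ ^ 2) ^ (r / 2)
          + K * 2 ^ n * (∑ k, ‖a k‖ ^ 2) ^ (r / 2)) := by
        rw [← Finset.mul_sum, Finset.sum_add_distrib]
        refine mul_le_mul_of_nonneg_left (add_le_add (h1.trans ?_) (h2.trans ?_)) (by positivity)
        · exact mul_le_mul_of_nonneg_left g1 (by positivity)
        · exact mul_le_mul_of_nonneg_left g2 (by positivity)
    _ = _ := by ring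

lemma lp_second_moment {𝕜 : Type*} [RCLike 𝕜] (n : ℕ) : ∀ (a : Fin n → 𝕜) (y : 𝕜),
      ∑ e : Fin n → Bool, ‖y + ∑ k, (lpSgn (e k) : 𝕜) * a k‖ ^ 2
        = 2 ^ n * (‖y‖ ^ 2 + ∑ k, ‖a k‖ ^ 2) := by
  induction n with
  | zero => intro a y; simp
  | succ n ih =>
    intro a y
    rw [← (Fin.consEquiv (fun _ : Fin (n+1) => Bool)).sum_comp, Fintype.sum_prod_type]
    simp only [Fin.consEquiv, Equiv.coe_fn_mk, Fin.sum_univ_succ, Fin.cons_zero, Fin.cons_succ,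
      ← add_assoc]
    simp only [ih (fun k => a k.succ), Fintype.sum_bool]
    have := parallelogram_law_with_norm 𝕜 y (a 0)
    simp only [lpSgn, if_true, Bool.false_eq_true, if_false, RCLike.ofReal_one, one_mul,
      RCLike.ofReal_neg, neg_mul, ← sub_eq_add_neg]
    rw [pow_succ]
    linear_combination (2:ℝ)^n * this

lemma lp_khin_lower (𝕜 : Type*) [RCLike 𝕜] (p : ℝ) (hp1 : 1 ≤ p) (hp2 : p ≤ 2) :
    ∃ K : ℝ, 0 ≤ K ∧ ∀ (n : ℕ) (a : Fin n → 𝕜),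
      2 ^ n * (∑ k, ‖a k‖ ^ 2) ^ (p / 2) ≤
      K * ∑ e : Fin n → Bool, ‖∑ k, (lpSgn (e k) : 𝕜) * a k‖ ^ p := by
  obtain ⟨K0, hK0, h0⟩ := lp_khin_upper 𝕜 4 (by norm_num)
  set K := K0 + 1
  have hK : 1 ≤ K := by simp only [K]; linarith
  refine ⟨4 * K, by positivity, fun n a => ?_⟩
  have hp : 0 < p := by linarith
  have hS : 0 ≤ ∑ k, ‖a k‖ ^ 2 := Finset.sum_nonneg fun _ _ => sq_nonneg _
  rcases hS.eq_or_lt with hz | hpos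
  · rw [← hz, Real.zero_rpow (by positivity)]
    simp only [mul_zero]; positivity
  set S := ∑ k, ‖a k‖ ^ 2 with hSdef
  have hs : 0 < √S := Real.sqrt_pos.2 hpos
  -- pointwise: t^2 ≤ 2K s^(2-p) t^p + t^4/(2 K S)
  have key : ∀ t : ℝ, 0 ≤ t → t ^ 2 ≤ 2 * K * (S ^ (1 - p/2) * t ^ p) + t ^ (4:ℝ) / (2 * K * S) := by
    intro t ht
    have e4 : t ^ (4:ℝ) = t ^ 4 := by exact_mod_cast Real.rpow_natCast t 4
    rw [e4]
    rcases le_total (t ^ 2) (2 * K * S) with h | h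
    · have : t ^ 2 ≤ 2 * K * (S ^ (1 - p/2) * t ^ p) := by
        calc t ^ 2 = (t ^ 2) ^ (1 - p/2) * t ^ p := by
              rcases ht.eq_or_lt with h | h
              · rw [← h, Real.zero_rpow hp.ne']; simp
              · rw [← Real.rpow_natCast t 2, ← Real.rpow_mul ht, ← Real.rpow_add h]
                congr 1; push_cast; ring
          _ ≤ (2 * K * S) ^ (1 - p/2) * t ^ p := by
              refine mul_le_mul_of_nonneg_right ?_ (by positivity)
              exact Real.rpow_le_rpow (by positivity) h (by linarith)
          _ = (2 * K) ^ (1 - p/2) * (S ^ (1 - p/2) * t ^ p) := by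
              rw [Real.mul_rpow (by positivity) hS]; ring
          _ ≤ _ := by
              refine mul_le_mul_of_nonneg_right ?_ (by positivity)
              conv_rhs => rw [← Real.rpow_one (2 * K)]
              exact Real.rpow_le_rpow_of_exponent_le (by linarith) (by linarith)
      have : 0 ≤ t ^ 4 / (2 * K * S) := by positivity
      linarith
    · have h1 : t ^ 2 ≤ t ^ 4 / (2 * K * S) := by
        rw [le_div_iff₀ (by positivity)]
        nlinarith [sq_nonneg t]
      have : 0 ≤ 2 * K * (S ^ (1 - p/2) * t ^ p) := by positivity
      linarith
  have h2 := lp_second_moment n a 0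
  simp only [zero_add, norm_zero, ne_eq, OfNat.ofNat_ne_zero, not_false_eq_true, zero_pow] at h2
  have h4 := h0 n a
  have e2 : (4:ℝ)/2 = (2:ℕ) := by norm_num
  rw [e2, Real.rpow_natCast] at h4
  have hsum := Finset.sum_le_sum fun (e : Fin n → Bool) (_ : e ∈ Finset.univ) =>
    key ‖∑ k, (lpSgn (e k) : 𝕜) * a k‖ (norm_nonneg _)
  rw [h2, Finset.sum_add_distrib, ← Finset.mul_sum, ← Finset.mul_sum, ← Finset.sum_div] at hsum
  set A := ∑ e : Fin n → Bool, ‖∑ k, (lpSgn (e k) : 𝕜) * a k‖ ^ p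
  have h5 : (∑ e : Fin n → Bool, ‖∑ k, (lpSgn (e k) : 𝕜) * a k‖ ^ (4:ℝ)) / (2 * K * S)
      ≤ 2 ^ n * S / 2 := by
    rw [div_le_iff₀ (by positivity)]
    refine h4.trans ?_
    have : K0 * (2 ^ n * S ^ 2) ≤ K * (2 ^ n * S ^ 2) := by
      refine mul_le_mul_of_nonneg_right ?_ (by positivity)
      simp only [K]; linarith
    calc _ = K0 * (2 ^ n * S ^ 2) := by ring
      _ ≤ _ := this
      _ = _ := by ring
  have h6 : 2 ^ n * S ≤ 4 * K * (S ^ (1 - p/2) * A) := by linarith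
  have h7 : S = S ^ (1 - p/2) * S ^ (p/2) := by
    rw [← Real.rpow_add hpos]; simp
  have h8 : 0 < S ^ (1 - p/2) := by positivity
  refine le_of_mul_le_mul_left ?_ h8
  calc _ = 2 ^ n * (S ^ (1 - p/2) * S ^ (p/2)) := by ring
    _ = 2 ^ n * S := by rw [← h7]
    _ ≤ _ := h6
    _ = _ := by ring

lemma lp_minkowski {n d : ℕ} (r : ℝ) (hr : 1 ≤ r) (g : Fin d → Fin n → ℝ) (hg : ∀ i k, 0 ≤ g i k)
    (s : Finset (Fin d)) :
    (∑ k, (∑ i ∈ s, g i k) ^ r) ^ (1 / r) ≤ ∑ i ∈ s, (∑ k, g i k ^ r) ^ (1 / r) := by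
  classical
  induction s using Finset.induction_on with
  | empty =>
    have : r ≠ 0 := by linarith
    simp [Real.zero_rpow this, Real.zero_rpow (inv_ne_zero this)]
  | insert a s ha ih =>
    simp only [Finset.sum_insert ha]
    refine (Real.Lp_add_le_of_nonneg Finset.univ hr (fun k _ => hg a k)
      (fun k _ => Finset.sum_nonneg fun i _ => hg i k)).trans ?_
    linarith

lemma lp_cotype_lp (𝕜 : Type*) [RCLike 𝕜] (p q : ℝ) (hp1 : 1 ≤ p) (hp2 : p ≤ 2) (hq : 2 < q)
    [Fact ((1 : ℝ≥0∞) ≤ ENNReal.ofReal p)] :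
    ∃ C : ℝ, 0 ≤ C ∧ ∀ (n d : ℕ)
      (y : Fin n → PiLp (ENNReal.ofReal p) (fun _ : Fin d => 𝕜)),
      (∑ k, ‖y k‖ ^ (2:ℝ)) ^ (1 / (2:ℝ)) ≤
        C * (∑ e : Fin n → Bool, 1 / 2 ^ n * ‖∑ k, (lpSgn (e k) : 𝕜) • y k‖ ^ q) ^ (1 / q) := by
  obtain ⟨K, hK, hlow⟩ := lp_khin_lower 𝕜 p hp1 hp2
  have hp : 0 < p := by linarith
  refine ⟨K ^ (1 / p), by positivity, fun n d y => ?_⟩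
  have htr : (ENNReal.ofReal p).toReal = p := ENNReal.toReal_ofReal hp.le
  have hnorm : ∀ z : PiLp (ENNReal.ofReal p) (fun _ : Fin d => 𝕜),
      ‖z‖ = (∑ i, ‖z i‖ ^ p) ^ (1 / p) := by
    intro z
    rw [PiLp.norm_eq_sum (by rw [htr]; exact hp), htr]
  have hnormp : ∀ z : PiLp (ENNReal.ofReal p) (fun _ : Fin d => 𝕜),
      ‖z‖ ^ p = ∑ i, ‖z i‖ ^ p := by
    intro z
    rw [hnorm, ← Real.rpow_mul (Finset.sum_nonneg fun _ _ => by positivity)]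
    rw [one_div_mul_cancel hp.ne', Real.rpow_one]
  set N : (Fin n → Bool) → ℝ := fun e => ‖∑ k, (lpSgn (e k) : 𝕜) • y k‖ with hN
  have hN0 : ∀ e, 0 ≤ N e := fun e => norm_nonneg _
  -- step 1
  have h1 : (∑ k, ‖y k‖ ^ (2:ℝ)) ^ (p / 2) ≤ ∑ i, (∑ k, ‖y k i‖ ^ 2) ^ (p / 2) := by
    have := lp_minkowski (2 / p) (by rw [le_div_iff₀ hp]; linarith)
      (fun i k => ‖y k i‖ ^ p) (fun i k => by positivity) Finset.univ
    have e1 : ∀ k, (∑ i, ‖y k i‖ ^ p) ^ (2 / p) = ‖y k‖ ^ (2:ℝ) := by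
      intro k
      rw [← hnormp, ← Real.rpow_mul (norm_nonneg _)]
      congr 1; field_simp
    have e2 : ∀ i k, (‖y k i‖ ^ p) ^ (2 / p) = ‖y k i‖ ^ 2 := by
      intro i k
      rw [← Real.rpow_mul (norm_nonneg _), ← Real.rpow_natCast]
      congr 1; push_cast; field_simp
    simp only [e1, e2, one_div_div] at this
    exact this
  -- step 2
  have h2 : ∑ i, (∑ k, ‖y k i‖ ^ 2) ^ (p / 2) ≤ K * ∑ e, 1 / 2 ^ n * N e ^ p := by
    have : ∀ i, (∑ k, ‖y k i‖ ^ 2) ^ (p / 2) ≤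
        K * ∑ e : Fin n → Bool, 1 / 2 ^ n * ‖(∑ k, (lpSgn (e k) : 𝕜) • y k) i‖ ^ p := by
      intro i
      have := hlow n (fun k => y k i)
      rw [← Finset.mul_sum, one_div, mul_left_comm, inv_mul_eq_div, le_div_iff₀ (by positivity),
        mul_comm]
      refine this.trans (le_of_eq ?_)
      congr 1
      refine Finset.sum_congr rfl fun e _ => ?_
      congr 2
      simp [RCLike.real_smul_eq_coe_mul]
    refine (Finset.sum_le_sum fun i _ => this i).trans (le_of_eq ?_)
    rw [← Finset.mul_sum, Finset.sum_comm]
    congr 1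
    refine Finset.sum_congr rfl fun e _ => ?_
    rw [← Finset.mul_sum, hN]
    simp only [hnormp]
  -- step 3
  have hw : ∑ _e : Fin n → Bool, (1:ℝ) / 2 ^ n = 1 := by
    simp
  have h3 : (∑ e, 1 / 2 ^ n * N e ^ p) ^ (q / p) ≤ ∑ e, 1 / 2 ^ n * N e ^ q := by
    have := Real.rpow_arith_mean_le_arith_mean_rpow Finset.univ
      (fun _ : Fin n → Bool => (1:ℝ) / 2 ^ n) (fun e => N e ^ p) (fun _ _ => by positivity) hw
      (fun e _ => by have := hN0 e; positivity) (p := q / p)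
      (by rw [le_div_iff₀ hp]; linarith)
    refine this.trans (le_of_eq ?_)
    refine Finset.sum_congr rfl fun e _ => ?_
    rw [← Real.rpow_mul (hN0 e)]
    congr 2; field_simp
  have hA : 0 ≤ ∑ e, 1 / 2 ^ n * N e ^ p :=
    Finset.sum_nonneg fun e _ => by have := hN0 e; positivity
  have hY0 : 0 ≤ ∑ k, ‖y k‖ ^ (2:ℝ) := Finset.sum_nonneg fun e _ => by positivity
  calc (∑ k, ‖y k‖ ^ (2:ℝ)) ^ (1 / (2:ℝ)) = ((∑ k, ‖y k‖ ^ (2:ℝ)) ^ (p / 2)) ^ (1 / p) := by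
        rw [← Real.rpow_mul hY0]; congr 1; field_simp
    _ ≤ (K * ∑ e, 1 / 2 ^ n * N e ^ p) ^ (1 / p) :=
        Real.rpow_le_rpow (by positivity) (h1.trans h2) (by positivity)
    _ = K ^ (1 / p) * ((∑ e, 1 / 2 ^ n * N e ^ p) ^ (q / p)) ^ (1 / q) := by
        rw [Real.mul_rpow hK hA, ← Real.rpow_mul hA]
        congr 2; field_simp
    _ ≤ _ := by
        refine mul_le_mul_of_nonneg_left ?_ (by positivity)
        exact Real.rpow_le_rpow (by positivity) h3 (by positivity)

/-- scaling of `ℓ_r` sums -/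
lemma lp_scale {ι : Type*} [Fintype ι] (r : ℝ) (hr : 0 < r) (c : ℝ) (hc : 0 ≤ c)
    (w a b : ι → ℝ) (hw : ∀ i, 0 ≤ w i) (ha : ∀ i, 0 ≤ a i) (hb : ∀ i, 0 ≤ b i)
    (hab : ∀ i, a i ≤ c * b i) :
    (∑ i, w i * a i ^ r) ^ (1 / r) ≤ c * (∑ i, w i * b i ^ r) ^ (1 / r) := by
  have e : c = (c ^ r) ^ (1 / r) := by
    rw [← Real.rpow_mul hc, mul_one_div_cancel hr.ne', Real.rpow_one]
  have hB : 0 ≤ ∑ i, w i * b i ^ r :=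
    Finset.sum_nonneg fun i _ => mul_nonneg (hw i) (Real.rpow_nonneg (hb i) _)
  have hA : 0 ≤ ∑ i, w i * a i ^ r :=
    Finset.sum_nonneg fun i _ => mul_nonneg (hw i) (Real.rpow_nonneg (ha i) _)
  rw [e, ← Real.mul_rpow (by positivity) hB]
  refine Real.rpow_le_rpow hA ?_ (by positivity)
  rw [Finset.mul_sum]
  refine Finset.sum_le_sum fun i _ => ?_
  calc w i * a i ^ r ≤ w i * (c * b i) ^ r :=
        mul_le_mul_of_nonneg_left (Real.rpow_le_rpow (ha i) (hab i) hr.le) (hw i)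
    _ = _ := by rw [Real.mul_rpow hc (hb i)]; ring

lemma lp_cotype_space {𝕜 : Type*} [RCLike 𝕜] {Z : Type*} [NormedAddCommGroup Z] [NormedSpace 𝕜 Z]
    (p q lam : ℝ) (hp1 : 1 ≤ p) (hp2 : p ≤ 2) (hq : 2 < q) (hlam : 1 < lam)
    (hZ : IsLpLambdaSpace 𝕜 p lam hp1 Z) :
    ∃ C : ℝ, 0 ≤ C ∧ ∀ (n : ℕ) (y : Fin n → Z),
      (∑ k, ‖y k‖ ^ (2:ℝ)) ^ (1 / (2:ℝ)) ≤
        C * (∑ e : Fin n → Bool, 1 / 2 ^ n * ‖∑ k, (lpSgn (e k) : 𝕜) • y k‖ ^ q) ^ (1 / q) := by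
  have : Fact ((1 : ℝ≥0∞) ≤ ENNReal.ofReal p) := ⟨ENNReal.one_le_ofReal.mpr hp1⟩
  obtain ⟨C, hC, h⟩ := lp_cotype_lp 𝕜 p q hp1 hp2 hq
  refine ⟨C * lam, by positivity, fun n y => ?_⟩
  obtain ⟨F, hEF, hF, v, hv⟩ := hZ (Submodule.span 𝕜 (Set.range y))
    (FiniteDimensional.span_of_finite 𝕜 (Set.finite_range y))
  set y' : Fin n → F := fun k => ⟨y k, hEF (Submodule.subset_span ⟨k, rfl⟩)⟩ with hy'
  set a := ‖(v : F →L[𝕜] PiLp (ENNReal.ofReal p) (fun _ : Fin (Module.finrank 𝕜 F) => 𝕜))‖ with ha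
  set b := ‖(v.symm :
      PiLp (ENNReal.ofReal p) (fun _ : Fin (Module.finrank 𝕜 F) => 𝕜) →L[𝕜] F)‖ with hb
  have ha0 : 0 ≤ a := norm_nonneg _
  have hb0 : 0 ≤ b := norm_nonneg _
  have h1 := h n _ (fun k => v (y' k))
  have h2 := lp_scale 2 (by norm_num) b hb0 (fun _ : Fin n => 1) (fun k => ‖y k‖)
    (fun k => ‖v (y' k)‖) (by simp) (by simp) (by simp) (fun k => by
      have := (v.symm : PiLp (ENNReal.ofReal p)
        (fun _ : Fin (Module.finrank 𝕜 F) => 𝕜) →L[𝕜] F).le_opNorm (v (y' k))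
      simpa [hy'] using this)
  have h3 := lp_scale q (by linarith) a ha0 (fun _ : Fin n → Bool => 1 / 2 ^ n)
    (fun e => ‖∑ k, (lpSgn (e k) : 𝕜) • v (y' k)‖)
    (fun e => ‖∑ k, (lpSgn (e k) : 𝕜) • y k‖) (fun _ => by positivity) (by simp) (by simp)
    (fun e => by
      have := (v : F →L[𝕜] PiLp (ENNReal.ofReal p)
        (fun _ : Fin (Module.finrank 𝕜 F) => 𝕜)).le_opNorm (∑ k, (lpSgn (e k) : 𝕜) • y' k)
      have e2 : ‖∑ k, (lpSgn (e k) : 𝕜) • y' k‖ = ‖∑ k, (lpSgn (e k) : 𝕜) • y k‖ := by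
        rw [Submodule.coe_norm]; simp [hy']
      rw [e2] at this
      simpa using this)
  simp only [one_mul] at h2
  set R := (∑ e : Fin n → Bool, 1 / 2 ^ n * ‖∑ k, (lpSgn (e k) : 𝕜) • y k‖ ^ q) ^ (1 / q) with hR
  have hR0 : 0 ≤ R := by positivity
  calc _ ≤ _ := h2
    _ ≤ b * (C * (a * R)) := by
        refine mul_le_mul_of_nonneg_left (h1.trans ?_) hb0
        exact mul_le_mul_of_nonneg_left h3 hC
    _ = C * (a * b) * R := by ring
    _ ≤ _ := by
        refine mul_le_mul_of_nonneg_right ?_ hR0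
        exact mul_le_mul_of_nonneg_left hv.le hC

lemma lp_poly_bound {𝕜 : Type*} [RCLike 𝕜] {X : Type*} [NormedAddCommGroup X] [NormedSpace 𝕜 X]
    (m : ℕ) (f : X → 𝕜) (hf : IsHomogPoly 𝕜 m f) (hn : polyNorm f ≤ 1) (x : X) :
    ‖f x‖ ≤ (max 1 ‖x‖) ^ m := by
  obtain ⟨T, hT⟩ := hf
  have hbdd : BddAbove (Set.range fun x : {x : X // ‖x‖ ≤ 1} => ‖f x.1‖) := by
    refine ⟨‖T‖, ?_⟩
    rintro _ ⟨⟨z, hz⟩, rfl⟩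
    simp only [hT]
    refine (T.le_opNorm _).trans ?_
    refine mul_le_of_le_one_right (norm_nonneg _) ?_
    exact Finset.prod_le_one (fun _ _ => norm_nonneg _) (fun _ _ => hz)
  set c := max 1 ‖x‖ with hc
  have hc1 : 1 ≤ c := le_max_left _ _
  have hc0 : 0 < c := by linarith
  set u : X := ((c⁻¹ : ℝ) : 𝕜) • x with hu
  have hu1 : ‖u‖ ≤ 1 := by
    rw [hu, norm_smul, RCLike.norm_ofReal, abs_of_pos (inv_pos.2 hc0), inv_mul_le_one₀ hc0]
    exact le_max_right _ _
  have hxu : x = (c : 𝕜) • u := by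
    rw [hu, smul_smul, ← RCLike.ofReal_mul, mul_inv_cancel₀ hc0.ne']; simp
  have h1 : ‖f u‖ ≤ 1 := (le_ciSup hbdd ⟨u, hu1⟩).trans hn
  have h2 : f x = (c : 𝕜) ^ m * f u := by
    rw [hT, hT, hxu]
    have := T.map_smul_univ (fun _ => (c : 𝕜)) (fun _ => u)
    simpa using this
  rw [h2, norm_mul, norm_pow, RCLike.norm_ofReal, abs_of_pos hc0]
  exact mul_le_of_le_one_right (by positivity) h1

lemma lp_bdd {𝕜 : Type*} [RCLike 𝕜] {X : Type*} [NormedAddCommGroup X] [NormedSpace 𝕜 X]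
    (m : ℕ) (r : ℝ) (hr : 0 < r) {J I : Type*} [Fintype J] [Fintype I]
    (x : J → I → X) (lam : J → I → 𝕜) :
    BddAbove (Set.range fun q : {q : X → 𝕜 // IsHomogPoly 𝕜 m q ∧ polyNorm q ≤ 1} =>
        (∑ j, ‖∑ i, lam j i • q.1 (x j i)‖ ^ r) ^ (1 / r)) := by
  refine ⟨(∑ j, (∑ i, ‖lam j i‖ * (max 1 ‖x j i‖) ^ m) ^ r) ^ (1 / r), ?_⟩
  rintro _ ⟨⟨f, hf, hn⟩, rfl⟩
  refine Real.rpow_le_rpow (by positivity) ?_ (by positivity)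
  refine Finset.sum_le_sum fun j _ => Real.rpow_le_rpow (norm_nonneg _) ?_ hr.le
  refine (norm_sum_le _ _).trans (Finset.sum_le_sum fun i _ => ?_)
  rw [norm_smul]
  exact mul_le_mul_of_nonneg_left (lp_poly_bound m f hf hn _) (norm_nonneg _)

lemma lp_bound_fintype {𝕜 : Type*} [RCLike 𝕜] {X Y : Type*} [NormedAddCommGroup X]
    [NormedSpace 𝕜 X] [NormedAddCommGroup Y] [NormedSpace 𝕜 Y]
    (m : ℕ) (r : ℝ) (P : X → Y) (C : ℝ) (h : FactStronglySummingPolyBound 𝕜 m r P C)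
    {J I : Type*} [Fintype J] [Fintype I] (x : J → I → X) (lam : J → I → 𝕜) :
    (∑ j, ‖∑ i, lam j i • P (x j i)‖ ^ r) ^ (1 / r) ≤
      C * ⨆ q : {q : X → 𝕜 // IsHomogPoly 𝕜 m q ∧ polyNorm q ≤ 1},
        (∑ j, ‖∑ i, lam j i • q.1 (x j i)‖ ^ r) ^ (1 / r) := by
  have := h.2 (Fintype.card J) (Fintype.card I)
    (fun j i => x ((Fintype.equivFin J).symm j) ((Fintype.equivFin I).symm i))
    (fun j i => lam ((Fintype.equivFin J).symm j) ((Fintype.equivFin I).symm i))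
  have key : ∀ {V : Type _} [NormedAddCommGroup V] [NormedSpace 𝕜 V] (g : X → V),
      ∑ j, ‖∑ i, lam ((Fintype.equivFin J).symm j) ((Fintype.equivFin I).symm i) •
        g (x ((Fintype.equivFin J).symm j) ((Fintype.equivFin I).symm i))‖ ^ r
      = ∑ j, ‖∑ i, lam j i • g (x j i)‖ ^ r := by
    intro V _ _ g
    rw [← (Fintype.equivFin J).symm.sum_comp (fun j => ‖∑ i, lam j i • g (x j i)‖ ^ r)]
    refine Finset.sum_congr rfl fun j _ => ?_
    congr 2
    exact (Fintype.equivFin I).symm.sum_comp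
      (fun i => lam ((Fintype.equivFin J).symm j) i • g (x ((Fintype.equivFin J).symm j) i))
  have key' : ∀ (g : X → 𝕜),
      ∑ j, ‖∑ i, lam ((Fintype.equivFin J).symm j) ((Fintype.equivFin I).symm i) •
        g (x ((Fintype.equivFin J).symm j) ((Fintype.equivFin I).symm i))‖ ^ r
      = ∑ j, ‖∑ i, lam j i • g (x j i)‖ ^ r := by
    intro g
    rw [← (Fintype.equivFin J).symm.sum_comp (fun j => ‖∑ i, lam j i • g (x j i)‖ ^ r)]
    refine Finset.sum_congr rfl fun j _ => ?_
    congr 2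
    exact (Fintype.equivFin I).symm.sum_comp
      (fun i => lam ((Fintype.equivFin J).symm j) i • g (x ((Fintype.equivFin J).symm j) i))
  rw [key P] at this
  simp only [key'] at this
  exact this

/-- The inclusion `2`-summing implies `q`-summing. -/
lemma lp_two_to_q {𝕜 : Type*} [RCLike 𝕜] {X Y : Type*} [NormedAddCommGroup X]
    [NormedSpace 𝕜 X] [NormedAddCommGroup Y] [NormedSpace 𝕜 Y]
    (m : ℕ) (q : ℝ) (hq : 2 < q) (P : X → Y) (C : ℝ)
    (h : FactStronglySummingPolyBound 𝕜 m 2 P C) : FactStronglySummingPolyBound 𝕜 m q P C := by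
  refine ⟨h.1, fun m₁ m₂ x lam => ?_⟩
  have hq0 : 0 < q := by linarith
  set a : Fin m₁ → ℝ := fun j => ‖∑ i, lam j i • P (x j i)‖ with ha
  have ha0 : ∀ j, 0 ≤ a j := fun j => norm_nonneg _
  set W := ⨆ q' : {q : X → 𝕜 // IsHomogPoly 𝕜 m q ∧ polyNorm q ≤ 1},
        (∑ j, ‖∑ i, lam j i • q'.1 (x j i)‖ ^ q) ^ (1 / q) with hW
  have hW0 : 0 ≤ W := Real.iSup_nonneg fun _ => by positivity
  set S := ∑ j, a j ^ q with hS
  have hS0 : 0 ≤ S := Finset.sum_nonneg fun j _ => Real.rpow_nonneg (ha0 j) _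
  change S ^ (1 / q) ≤ C * W
  rcases hS0.eq_or_lt with hz | hpos
  · rw [← hz, Real.zero_rpow (by positivity)]
    exact mul_nonneg h.1 hW0
  set t : Fin m₁ → ℝ := fun j => a j ^ (q / 2 - 1) with ht
  have ht0 : ∀ j, 0 ≤ t j := fun j => Real.rpow_nonneg (ha0 j) _
  have h1 := h.2 m₁ m₂ x (fun j i => (t j : 𝕜) * lam j i)
  have e1 : ∀ j, ‖∑ i, ((t j : 𝕜) * lam j i) • P (x j i)‖ ^ (2:ℝ) = a j ^ q := by
    intro j
    simp only [mul_smul, ← Finset.smul_sum]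
    rw [norm_smul, RCLike.norm_ofReal, abs_of_nonneg (ht0 j)]
    change (t j * a j) ^ (2:ℝ) = _
    rw [Real.mul_rpow (ht0 j) (ha0 j)]
    rcases (ha0 j).eq_or_lt with hj | hj
    · rw [← hj, Real.zero_rpow hq0.ne', Real.zero_rpow (by norm_num), mul_zero]
    · rw [← Real.rpow_mul (ha0 j), ← Real.rpow_add hj]
      congr 1; ring
  have e2 : ∀ f : {q : X → 𝕜 // IsHomogPoly 𝕜 m q ∧ polyNorm q ≤ 1},
      (∑ j, ‖∑ i, ((t j : 𝕜) * lam j i) • f.1 (x j i)‖ ^ (2:ℝ)) ^ (1 / (2:ℝ))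
        ≤ S ^ (1/2 - 1/q) * W := by
    intro f
    set b : Fin m₁ → ℝ := fun j => ‖∑ i, lam j i • f.1 (x j i)‖ with hb
    have hb0 : ∀ j, 0 ≤ b j := fun j => norm_nonneg _
    have e3 : ∀ j, ‖∑ i, ((t j : 𝕜) * lam j i) • f.1 (x j i)‖ ^ (2:ℝ)
        = a j ^ (q - 2) * b j ^ (2:ℝ) := by
      intro j
      simp only [mul_smul, ← Finset.smul_sum]
      rw [norm_smul, RCLike.norm_ofReal, abs_of_nonneg (ht0 j)]
      change (t j * b j) ^ (2:ℝ) = _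
      rw [Real.mul_rpow (ht0 j) (hb0 j), ← Real.rpow_mul (ha0 j)]
      congr 2; ring
    have hold := Real.inner_le_Lp_mul_Lq_of_nonneg Finset.univ
      (p := q / (q - 2)) (q := q / 2)
      (by
        rw [Real.holderConjugate_iff]
        have : 0 < q - 2 := by linarith
        constructor
        · rw [lt_div_iff₀ this]; linarith
        · field_simp; ring)
      (f := fun j => a j ^ (q - 2)) (g := fun j => b j ^ (2:ℝ))
      (fun j _ => Real.rpow_nonneg (ha0 j) _) (fun j _ => Real.rpow_nonneg (hb0 j) _)
    have hq2 : q - 2 ≠ 0 := by linarith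
    have e4 : ∀ j, (a j ^ (q - 2)) ^ (q / (q - 2)) = a j ^ q := fun j => by
      rw [← Real.rpow_mul (ha0 j)]; congr 1; field_simp
    have e5 : ∀ j, (b j ^ (2:ℝ)) ^ (q / 2) = b j ^ q := fun j => by
      rw [← Real.rpow_mul (hb0 j)]; congr 1; field_simp
    simp only [e4, e5, one_div_div] at hold
    simp only [e3]
    have hB0 : 0 ≤ ∑ j, b j ^ q := Finset.sum_nonneg fun j _ => Real.rpow_nonneg (hb0 j) _
    have hfW : (∑ j, b j ^ q) ^ (1 / q) ≤ W := le_ciSup (lp_bdd m q hq0 x lam) f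
    calc (∑ j, a j ^ (q - 2) * b j ^ (2:ℝ)) ^ (1 / (2:ℝ))
        ≤ (S ^ ((q - 2) / q) * (∑ j, b j ^ q) ^ (2 / q)) ^ (1 / (2:ℝ)) :=
          Real.rpow_le_rpow (Finset.sum_nonneg fun j _ =>
            mul_nonneg (Real.rpow_nonneg (ha0 j) _) (Real.rpow_nonneg (hb0 j) _)) hold
            (by norm_num)
      _ = S ^ (1/2 - 1/q) * (∑ j, b j ^ q) ^ (1 / q) := by
          rw [Real.mul_rpow (by positivity) (by positivity), ← Real.rpow_mul hS0,
            ← Real.rpow_mul hB0]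
          congr 2 <;> field_simp
      _ ≤ _ := mul_le_mul_of_nonneg_left hfW (by positivity)
  simp only [e1] at h1
  have h2 : S ^ (1 / (2:ℝ)) ≤ C * (S ^ (1/2 - 1/q) * W) :=
    h1.trans (mul_le_mul_of_nonneg_left
      (Real.iSup_le e2 (mul_nonneg (by positivity) hW0)) h.1)
  have h3 : S ^ (1 / (2:ℝ)) = S ^ (1/2 - 1/q) * S ^ (1/q) := by
    rw [← Real.rpow_add hpos]; congr 1; ring
  refine le_of_mul_le_mul_left (a := S ^ (1/2 - 1/q)) ?_ (by positivity)
  rw [← h3]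
  refine h2.trans (le_of_eq (by ring))

/-- `q`-summing implies `2`-summing when the target has cotype two. -/
lemma lp_q_to_two {𝕜 : Type*} [RCLike 𝕜] {X Y : Type*} [NormedAddCommGroup X]
    [NormedSpace 𝕜 X] [NormedAddCommGroup Y] [NormedSpace 𝕜 Y]
    (m : ℕ) (q : ℝ) (hq : 2 < q) (P : X → Y) (C C₁ : ℝ) (hC₁ : 0 ≤ C₁)
    (hcot : ∀ (n : ℕ) (y : Fin n → Y),
      (∑ k, ‖y k‖ ^ (2:ℝ)) ^ (1 / (2:ℝ)) ≤
        C₁ * (∑ e : Fin n → Bool, 1 / 2 ^ n * ‖∑ k, (lpSgn (e k) : 𝕜) • y k‖ ^ q) ^ (1 / q))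
    (h : FactStronglySummingPolyBound 𝕜 m q P C) :
    ∃ C', FactStronglySummingPolyBound 𝕜 m 2 P C' := by
  have hq0 : 0 < q := by linarith
  obtain ⟨K, hK, hup⟩ := lp_khin_upper 𝕜 q hq0
  have hC := h.1
  refine ⟨C₁ * (C * K ^ (1 / q)), by positivity, fun n m₂ x lam => ?_⟩
  set W := ⨆ q' : {q : X → 𝕜 // IsHomogPoly 𝕜 m q ∧ polyNorm q ≤ 1},
        (∑ j, ‖∑ i, lam j i • q'.1 (x j i)‖ ^ (2:ℝ)) ^ (1 / (2:ℝ)) with hW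
  have hW0 : 0 ≤ W := Real.iSup_nonneg fun _ => by positivity
  refine (hcot n _).trans ?_
  rw [mul_assoc, mul_assoc]
  refine mul_le_mul_of_nonneg_left ?_ hC₁
  set c : ℝ := (1 / 2 ^ n) ^ (1 / q) with hc
  have hc0 : 0 ≤ c := by positivity
  have hcq : c ^ q = 1 / 2 ^ n := by
    rw [hc, ← Real.rpow_mul (by positivity), one_div_mul_cancel hq0.ne', Real.rpow_one]
  have h1 := lp_bound_fintype m q P C h (J := Fin n → Bool) (I := Fin n × Fin m₂)
    (fun _ z => x z.1 z.2) (fun e z => (c : 𝕜) * ((lpSgn (e z.1) : 𝕜) * lam z.1 z.2))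
  have e1 : ∀ e : Fin n → Bool, ‖∑ z : Fin n × Fin m₂,
      ((c : 𝕜) * ((lpSgn (e z.1) : 𝕜) * lam z.1 z.2)) • P (x z.1 z.2)‖ ^ q
      = 1 / 2 ^ n * ‖∑ k, (lpSgn (e k) : 𝕜) • ∑ i, lam k i • P (x k i)‖ ^ q := by
    intro e
    simp only [mul_smul, ← Finset.smul_sum, Fintype.sum_prod_type]
    rw [norm_smul, RCLike.norm_ofReal, abs_of_nonneg hc0, Real.mul_rpow hc0 (norm_nonneg _), hcq]
  have e2 : ∀ (f : X → 𝕜) (e : Fin n → Bool), ‖∑ z : Fin n × Fin m₂,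
      ((c : 𝕜) * ((lpSgn (e z.1) : 𝕜) * lam z.1 z.2)) • f (x z.1 z.2)‖ ^ q
      = 1 / 2 ^ n * ‖∑ k, (lpSgn (e k) : 𝕜) * ∑ i, lam k i • f (x k i)‖ ^ q := by
    intro f e
    simp only [mul_smul, ← Finset.smul_sum, Fintype.sum_prod_type]
    rw [norm_smul, RCLike.norm_ofReal, abs_of_nonneg hc0, Real.mul_rpow hc0 (norm_nonneg _), hcq]
    simp only [smul_eq_mul]
  simp only [e1, e2] at h1
  refine h1.trans (mul_le_mul_of_nonneg_left ?_ hC)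
  refine Real.iSup_le (fun f => ?_) (by positivity)
  have h2 := hup n (fun k => ∑ i, lam k i • f.1 (x k i))
  set b : Fin n → 𝕜 := fun k => ∑ i, lam k i • f.1 (x k i) with hb
  have hfW : (∑ k, ‖b k‖ ^ (2:ℝ)) ^ (1 / (2:ℝ)) ≤ W :=
    le_ciSup (lp_bdd m 2 (by norm_num) x lam) f
  have e3 : ∑ k, ‖b k‖ ^ (2:ℝ) = ∑ k, ‖b k‖ ^ 2 :=
    Finset.sum_congr rfl fun k _ => by exact_mod_cast Real.rpow_natCast ‖b k‖ 2
  rw [e3] at hfW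
  have hB : 0 ≤ ∑ k, ‖b k‖ ^ 2 := by positivity
  rw [← Finset.mul_sum]
  calc (1 / 2 ^ n * ∑ e : Fin n → Bool, ‖∑ k, (lpSgn (e k) : 𝕜) * b k‖ ^ q) ^ (1 / q)
      ≤ (K * (∑ k, ‖b k‖ ^ 2) ^ (q / 2)) ^ (1 / q) := by
        refine Real.rpow_le_rpow (by positivity) ?_ (by positivity)
        rw [one_div, inv_mul_le_iff₀ (by positivity)]
        refine h2.trans (le_of_eq (by ring))
    _ = K ^ (1 / q) * (∑ k, ‖b k‖ ^ 2) ^ (1 / (2:ℝ)) := by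
        rw [Real.mul_rpow hK (by positivity), ← Real.rpow_mul hB]
        congr 2; field_simp
    _ ≤ _ := mul_le_mul_of_nonneg_left hfW (by positivity)

/-- Lindenstrauss–Pełczyński type theorem: let `1 ≤ p ≤ 2 < q < ∞` and
let `Y` be a (closed) subspace of an `L_{p,λ}`-space. Then an `m`-homogeneous polynomial
`P : X → Y` is factorable strongly `q`-summing iff it is factorable strongly
`2`-summing. -/
theorem lindenstrauss_pelczynski_factStronglySummingPoly
    {𝕜 : Type*} [RCLike 𝕜] {X Y : Type*}
    [NormedAddCommGroup X] [NormedSpace 𝕜 X] [CompleteSpace X]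
    [NormedAddCommGroup Y] [NormedSpace 𝕜 Y] [CompleteSpace Y]
    (m : ℕ) (hm : 0 < m) (p q lam : ℝ) (hp1 : 1 ≤ p) (hp2 : p ≤ 2) (hq : 2 < q)
    (hlam : 1 < lam)
    (hY : ∃ (Z : Type _) (_ : NormedAddCommGroup Z) (_ : NormedSpace 𝕜 Z)
      (_ : CompleteSpace Z), IsLpLambdaSpace 𝕜 p lam hp1 Z ∧ Nonempty (Y →ₗᵢ[𝕜] Z)) :
    ∀ P : X → Y, IsHomogPoly 𝕜 m P →
      (FactStronglySummingPoly 𝕜 m q P ↔ FactStronglySummingPoly 𝕜 m 2 P) := by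
  intro P hP
  constructor
  · rintro ⟨_, C, hC⟩
    refine ⟨hP, ?_⟩
    obtain ⟨Z, _, _, _, hZ, ⟨ψ⟩⟩ := hY
    obtain ⟨C₁, hC₁, hcot⟩ := lp_cotype_space p q lam hp1 hp2 hq hlam hZ
    refine lp_q_to_two m q hq P C C₁ hC₁ (fun n y => ?_) hC
    have := hcot n (fun k => ψ (y k))
    simp only [← map_smul, ← map_sum, LinearIsometry.norm_map] at this
    exact this
  · rintro ⟨_, C, hC⟩
    exact ⟨hP, C, lp_two_to_q m q hq P C hC⟩
end

section
/- Let 1 ≤ p < ∞. Every factorable strongly p-summing m-homogeneous polynomial P : X → Y between Banach spaces is weakly compact, i.e., the image P(B_X) of the closed unit ball B_X of X has compact closure in Y endowed with its weak topology. -/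
open scoped BigOperators
open MeasureTheory

section Proof
open Filter Topology
open scoped BoundedContinuousFunction

theorem isCompact_closure_range_of_ultrafilter {α β : Type*} [TopologicalSpace β] [RegularSpace β]
    (φ : α → β) (h : ∀ V : Ultrafilter α, ∃ y, Tendsto φ V (𝓝 y)) :
    IsCompact (closure (Set.range φ)) := by
  rw [isCompact_iff_ultrafilter_le_nhds]
  intro F hF
  rw [le_principal_iff] at hF
  have hne : (comap φ ((F : Filter β).bind 𝓝)).NeBot := by
    rw [comap_neBot_iff]
    intro S hS
    rw [mem_bind'] at hS
    obtain ⟨x, hx1, hx2⟩ := F.neBot.nonempty_of_mem (inter_mem hS hF)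
    obtain ⟨z, hz, ⟨b, rfl⟩⟩ := mem_closure_iff_nhds.1 hx2 S hx1
    exact ⟨b, hz⟩
  obtain ⟨y, hy⟩ := h (Ultrafilter.of (comap φ ((F : Filter β).bind 𝓝)))
  have key : (F : Filter β) ≤ 𝓝 y := by
    rw [(closed_nhds_basis y).ge_iff]
    rintro N ⟨hN, hNc⟩
    by_contra hcon
    have h1 : Nᶜ ∈ F := Ultrafilter.compl_mem_iff_notMem.2 hcon
    have h2 : Nᶜ ∈ (F : Filter β).bind 𝓝 := by
      rw [mem_bind']
      filter_upwards [h1] with x hx using hNc.isOpen_compl.mem_nhds hx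
    have h3 : φ ⁻¹' Nᶜ ∈ Ultrafilter.of (comap φ ((F : Filter β).bind 𝓝)) :=
      Ultrafilter.of_le _ (preimage_mem_comap h2)
    have h4 := hy hN
    obtain ⟨x, hx1, hx2⟩ := (Ultrafilter.neBot _).nonempty_of_mem (inter_mem h3 h4)
    exact hx1 hx2
  refine ⟨y, ?_, key⟩
  have : ClusterPt y (𝓟 (closure (Set.range φ))) := by
    have : (F : Filter β) ≤ 𝓝 y ⊓ 𝓟 (closure (Set.range φ)) := le_inf key (le_principal_iff.2 hF)
    exact NeBot.mono F.neBot this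
  exact isClosed_iff_clusterPt.1 isClosed_closure y this

theorem positive_functional {B : Type*} [TopologicalSpace B] [Nonempty B]
    (G : Set (B →ᵇ ℝ)) (hG0 : G.Nonempty)
    (hG : ∀ t : ℝ, 0 ≤ t → ∀ g ∈ G, t • g ∈ G)
    (h : ∀ g ∈ convexHull ℝ G, ∀ ε > 0, ∃ q, -ε < g q) :
    ∃ f : (B →ᵇ ℝ) →L[ℝ] ℝ, (∀ g : B →ᵇ ℝ, (∀ q, 0 ≤ g q) → 0 ≤ f g) ∧ (∀ g ∈ G, 0 ≤ f g) ∧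
      0 < f (BoundedContinuousFunction.const B 1) := by
  set N : Set (B →ᵇ ℝ) := {g | ∃ ε > 0, ∀ q, g q ≤ -ε} with hN
  have hNc : Convex ℝ N := by
    rintro g ⟨ε, hε, hg⟩ g' ⟨ε', hε', hg'⟩ s t hs ht hst
    refine ⟨min ε ε', lt_min hε hε', fun q => ?_⟩
    have h1 := hg q
    have h2 := hg' q
    have h3 := min_le_left ε ε'
    have h4 := min_le_right ε ε'
    have h5 : s * g q ≤ s * (-(min ε ε')) := mul_le_mul_of_nonneg_left (by linarith) hs
    have h6 : t * g' q ≤ t * (-(min ε ε')) := mul_le_mul_of_nonneg_left (by linarith) ht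
    have : (s • g + t • g') q = s * g q + t * g' q := by simp
    rw [this]
    calc _ ≤ (s + t) * (-(min ε ε')) := by linarith
      _ = _ := by rw [hst]; ring
  have hNo : IsOpen N := by
    rw [Metric.isOpen_iff]
    rintro g ⟨ε, hε, hg⟩
    refine ⟨ε / 2, by positivity, fun g' hg' => ⟨ε / 2, by positivity, fun q => ?_⟩⟩
    have h1 := (BoundedContinuousFunction.dist_coe_le_dist (f := g') (g := g) q).trans_lt hg'
    rw [Real.dist_eq, abs_lt] at h1
    linarith [hg q]
  have hdisj : Disjoint N (convexHull ℝ G) := by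
    rw [Set.disjoint_left]
    rintro g ⟨ε, hε, hg⟩ hg2
    obtain ⟨q, hq⟩ := h g hg2 ε hε
    linarith [hg q]
  obtain ⟨f, u, hf1, hf2⟩ := geometric_hahn_banach_open hNc hNo (convex_convexHull ℝ G) hdisj
  have hG' : ∀ g ∈ G, u ≤ f g := fun g hg => hf2 g (subset_convexHull ℝ G hg)
  have hu : u ≤ 0 := by
    obtain ⟨g, hg⟩ := hG0
    simpa using hG' _ (hG 0 le_rfl g hg)
  have h1 : 0 < f (BoundedContinuousFunction.const B 1) := by
    have : f (-(BoundedContinuousFunction.const B 1)) < u := 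
      hf1 _ ⟨1, one_pos, fun q => by simp⟩
    rw [map_neg] at this
    linarith
  refine ⟨f, ?_, ?_, h1⟩
  · intro g hg
    by_contra! hcon
    set c := f (BoundedContinuousFunction.const B 1)
    have : f (-((-(f g) / (2 * c)) • (BoundedContinuousFunction.const B 1) + g)) < u := by
      refine hf1 _ ⟨-(f g) / (2 * c), div_pos (by linarith) (by linarith), fun q => ?_⟩
      have := hg q
      simp
      linarith
    rw [map_neg, map_add, map_smul, smul_eq_mul] at this
    change -(-(f g) / (2 * c) * c + f g) < u at this
    have h2 : -(f g) / (2 * c) * c = - f g / 2 := by field_simp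
    rw [h2] at this
    linarith
  · intro g hg
    by_contra! hcon
    have := hG' _ (hG ((u - 1) / f g) (div_nonneg_of_nonpos (by linarith) hcon.le) g hg)
    rw [map_smul, smul_eq_mul, div_mul_cancel₀ _ hcon.ne] at this
    linarith

theorem weak_limit {𝕜 : Type*} [RCLike 𝕜] {E Y B : Type*} [AddCommGroup E] [Module 𝕜 E] [Module ℝ E]
    [IsScalarTower ℝ 𝕜 E] [NormedAddCommGroup Y] [NormedSpace 𝕜 Y] [CompleteSpace Y]
    (δ : B → E) (T : E →ₗ[𝕜] Y) (R : ℝ) (hR : ∀ x, ‖T (δ x)‖ ≤ R) (Q : E → ℝ) (hQ0 : ∀ a, 0 ≤ Q a)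
    (M : ℝ) (hM : ∀ a ∈ convexHull ℝ (Set.range δ), Q a ≤ M)
    (hpar : ∀ a b, Q (a - b) = 2 * Q a + 2 * Q b - 4 * Q ((1 / 2 : ℝ) • a + (1 / 2 : ℝ) • b))
    (hT : ∀ ε > 0, ∃ η > 0, ∀ a ∈ convexHull ℝ (Set.range δ), ∀ b ∈ convexHull ℝ (Set.range δ),
      Q (a - b) < η → ‖T (a - b)‖ < ε) (V : Ultrafilter B) :
    ∃ y : Y, ∀ φ : Y →L[𝕜] 𝕜, Tendsto (fun x => φ (T (δ x))) V (𝓝 (φ y)) := by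
  set K : Set B → Set E := fun S => convexHull ℝ (δ '' S) with hK
  have hKm : Monotone K := fun S S' h => convexHull_mono (Set.image_mono h)
  have hKr : ∀ S, K S ⊆ convexHull ℝ (Set.range δ) := fun S =>
    convexHull_mono (Set.image_subset_range _ _)
  have hKne : ∀ S ∈ V, (K S).Nonempty := fun S hS =>
    ((V.neBot.nonempty_of_mem hS).image δ).convexHull
  set D : Set ℝ := {r | ∃ S ∈ V, ∀ a ∈ K S, r ≤ Q a} with hD
  have hD0 : D.Nonempty := ⟨0, Set.univ, univ_mem, fun a _ => hQ0 a⟩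
  have hDb : BddAbove D := by
    refine ⟨M, ?_⟩
    rintro r ⟨S, hS, hr⟩
    obtain ⟨a, ha⟩ := hKne S hS
    exact (hr a ha).trans (hM a (hKr S ha))
  set d := sSup D with hd
  have hlow : ∀ ε > 0, ∃ S ∈ V, ∀ a ∈ K S, d - ε < Q a := by
    intro ε hε
    obtain ⟨r, ⟨S, hS, hr⟩, hlt⟩ := exists_lt_of_lt_csSup hD0 (show d - ε < sSup D by linarith)
    exact ⟨S, hS, fun a ha => hlt.trans_le (hr a ha)⟩
  have hup : ∀ ε > 0, ∀ S ∈ V, ∃ a ∈ K S, Q a < d + ε := by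
    intro ε hε S hS
    by_contra! hcon
    have := le_csSup hDb ⟨S, hS, hcon⟩
    linarith
  set l : Filter E := (V : Filter B).lift' K ⊓ comap Q (𝓝 d) with hl
  have hlne : l.NeBot := by
    rw [hl, inf_neBot_iff]
    intro s hs s' hs'
    rw [mem_lift'_sets hKm] at hs
    obtain ⟨t, ht, hts⟩ := hs
    obtain ⟨W, hW, hWs⟩ := hs'
    obtain ⟨ε, hε, hb⟩ := Metric.mem_nhds_iff.1 hW
    obtain ⟨S, hS, hSl⟩ := hlow ε hε
    obtain ⟨a, ha, haQ⟩ := hup ε hε (t ∩ S) (inter_mem ht hS)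
    refine ⟨a, hts (hKm Set.inter_subset_left ha), hWs (hb ?_)⟩
    have := hSl a (hKm Set.inter_subset_right ha)
    rw [Metric.mem_ball, Real.dist_eq, abs_lt]
    constructor <;> linarith
  have hc : Cauchy (map T l) := by
    rw [Metric.cauchy_iff]
    refine ⟨inferInstance, fun ε hε => ?_⟩
    obtain ⟨η, hη, hT⟩ := hT ε hε
    obtain ⟨S, hS, hSl⟩ := hlow (η / 8) (by positivity)
    refine ⟨T '' (K S ∩ Q ⁻¹' Metric.ball d (η / 8)), image_mem_map
      (inter_mem_inf (mem_lift' hS) (preimage_mem_comap (Metric.ball_mem_nhds _ (by positivity)))), ?_⟩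
    rintro _ ⟨a, ⟨ha, haQ⟩, rfl⟩ _ ⟨b, ⟨hb, hbQ⟩, rfl⟩
    rw [dist_eq_norm, ← map_sub]
    apply hT a (hKr S ha) b (hKr S hb)
    rw [hpar]
    have h1 := hSl _ ((convex_convexHull ℝ (δ '' S)) ha hb (by norm_num : (0:ℝ) ≤ 1/2)
      (by norm_num : (0:ℝ) ≤ 1/2) (by norm_num))
    rw [Set.mem_preimage, Metric.mem_ball, Real.dist_eq, abs_lt] at haQ hbQ
    linarith
  obtain ⟨y, hy⟩ := CompleteSpace.complete hc
  refine ⟨y, fun φ => ?_⟩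
  have hcomp : IsCompact (Metric.closedBall (0 : 𝕜) (‖φ‖ * R)) := isCompact_closedBall _ _
  obtain ⟨c, -, hcV⟩ := hcomp.ultrafilter_le_nhds (V.map fun x => φ (T (δ x))) (by
    rw [le_principal_iff]
    refine Filter.mem_map.2 (Filter.univ_mem' fun x => ?_)
    simp only [Set.mem_preimage, mem_closedBall_zero_iff]
    exact (φ.le_opNorm _).trans (mul_le_mul_of_nonneg_left (hR x) (norm_nonneg _)))
  have hcV' : Tendsto (fun x => φ (T (δ x))) V (𝓝 c) := hcV
  have h1 : Tendsto (fun a => φ (T a)) l (𝓝 (φ y)) := (φ.continuous.tendsto y).comp hy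
  have h2 : Tendsto (fun a => φ (T a)) l (𝓝 c) := by
    refine Tendsto.mono_left ?_ (inf_le_left : l ≤ _)
    rw [Metric.nhds_basis_closedBall.tendsto_right_iff]
    intro ε hε
    have hS := hcV' (Metric.closedBall_mem_nhds c hε)
    rw [Filter.mem_map] at hS
    refine mem_of_superset (mem_lift' hS) ?_
    set ψ : E →ₗ[ℝ] 𝕜 := (φ.toLinearMap ∘ₗ T).restrictScalars ℝ
    have : K ((fun x => φ (T (δ x))) ⁻¹' Metric.closedBall c ε) ⊆ ψ ⁻¹' Metric.closedBall c ε := by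
      refine convexHull_min ?_ ((convex_closedBall c ε).linear_preimage ψ)
      rintro _ ⟨x, hx, rfl⟩
      exact hx
    exact this
  rw [tendsto_nhds_unique h1 h2]
  exact hcV'

section Aux

variable {𝕜 : Type*} [RCLike 𝕜] {X Y : Type*} [NormedAddCommGroup X] [NormedSpace 𝕜 X]
    [NormedAddCommGroup Y] [NormedSpace 𝕜 Y]

theorem homogPoly_bounded {m : ℕ} {P : X → Y} (hP : IsHomogPoly 𝕜 m P) :
    ∃ R, ∀ x : {x : X // ‖x‖ ≤ 1}, ‖P x.1‖ ≤ R := by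
  obtain ⟨T, hT⟩ := hP
  refine ⟨‖T‖, fun x => ?_⟩
  rw [hT]
  refine (T.le_opNorm _).trans (mul_le_of_le_one_right (norm_nonneg _) ?_)
  exact Finset.prod_le_one (fun _ _ => norm_nonneg _) (fun _ _ => x.2)

theorem homogPoly_le_polyNorm {m : ℕ} {P : X → Y} (hP : IsHomogPoly 𝕜 m P)
    (x : {x : X // ‖x‖ ≤ 1}) : ‖P x.1‖ ≤ polyNorm P := by
  obtain ⟨R, hR⟩ := homogPoly_bounded hP
  exact le_ciSup (f := fun x : {x : X // ‖x‖ ≤ 1} => ‖P x.1‖)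
    ⟨R, by rintro _ ⟨x, rfl⟩; exact hR x⟩ x

theorem finsupp_bound {m : ℕ} {p : ℝ} {P : X → Y} {C : ℝ}
    (h : FactStronglySummingPolyBound 𝕜 m p P C) {ι : Type*} [Fintype ι]
    (a : ι → ({x : X // ‖x‖ ≤ 1} →₀ 𝕜)) :
    (∑ j, ‖Finsupp.linearCombination 𝕜 (fun x : {x : X // ‖x‖ ≤ 1} => P x.1) (a j)‖ ^ p) ^ (1 / p) ≤
      C * ⨆ q : {q : X → 𝕜 // IsHomogPoly 𝕜 m q ∧ polyNorm q ≤ 1},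
        (∑ j, ‖Finsupp.linearCombination 𝕜 (fun x : {x : X // ‖x‖ ≤ 1} => q.1 x.1) (a j)‖ ^ p)
          ^ (1 / p) := by
  classical
  set s : Finset {x : X // ‖x‖ ≤ 1} := Finset.univ.biUnion fun j => (a j).support with hs
  have key : ∀ (g : X → Y) (j : ι),
      ∑ i : Fin s.card, a j (s.equivFin.symm i).1 • g (s.equivFin.symm i).1.1 =
        Finsupp.linearCombination 𝕜 (fun x : {x : X // ‖x‖ ≤ 1} => g x.1) (a j) := by
    intro g j
    rw [Finsupp.linearCombination_apply, Finsupp.sum_of_support_subset (a j)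
      (s := s) (Finset.subset_biUnion_of_mem (fun j => (a j).support) (Finset.mem_univ j)) _ (by simp),
      ← Finset.sum_coe_sort s]
    exact Equiv.sum_comp s.equivFin.symm (fun x : s => a j x.1 • g x.1.1)
  have key' : ∀ (g : X → 𝕜) (j : ι),
      ∑ i : Fin s.card, a j (s.equivFin.symm i).1 • g (s.equivFin.symm i).1.1 =
        Finsupp.linearCombination 𝕜 (fun x : {x : X // ‖x‖ ≤ 1} => g x.1) (a j) := by
    intro g j
    rw [Finsupp.linearCombination_apply, Finsupp.sum_of_support_subset (a j)
      (s := s) (Finset.subset_biUnion_of_mem (fun j => (a j).support) (Finset.mem_univ j)) _ (by simp),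
      ← Finset.sum_coe_sort s]
    exact Equiv.sum_comp s.equivFin.symm (fun x : s => a j x.1 • g x.1.1)
  have := h.2 (Fintype.card ι) s.card (fun _ i => (s.equivFin.symm i).1.1)
    (fun j i => a ((Fintype.equivFin ι).symm j) (s.equivFin.symm i).1)
  simp only [key, key'] at this
  have re : ∀ f : ι → ℝ, ∑ j, f ((Fintype.equivFin ι).symm j) = ∑ j, f j := fun f =>
    Equiv.sum_comp (Fintype.equivFin ι).symm f
  rw [re (fun j => ‖Finsupp.linearCombination 𝕜 (fun x : {x : X // ‖x‖ ≤ 1} => P x.1) (a j)‖ ^ p)]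
    at this
  have re2 : ∀ q : {q : X → 𝕜 // IsHomogPoly 𝕜 m q ∧ polyNorm q ≤ 1}, _ := fun q =>
    re (fun j => ‖Finsupp.linearCombination 𝕜 (fun x : {x : X // ‖x‖ ≤ 1} => q.1 x.1) (a j)‖ ^ p)
  simp only [re2] at this
  exact this

end Aux

/-- Domination: abstract version. -/
theorem exists_domination {𝕜 : Type*} [RCLike 𝕜] {E Y B : Type*} [AddCommGroup E] [Module 𝕜 E]
    [NormedAddCommGroup Y] [NormedSpace 𝕜 Y] [TopologicalSpace B] [Nonempty B]
    (T : E →ₗ[𝕜] Y) (ev : B → E →ₗ[𝕜] 𝕜) {p C : ℝ} (hp : 1 ≤ p) (hC : 0 ≤ C)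
    (N : E → (B →ᵇ ℝ)) (hN : ∀ a q, N a q = ‖ev q a‖ ^ p)
    (h : ∀ (ι : Type) [Fintype ι] (a : ι → E),
      (∑ j, ‖T (a j)‖ ^ p) ^ (1 / p) ≤ C * ⨆ q : B, (∑ j, ‖ev q (a j)‖ ^ p) ^ (1 / p)) :
    ∃ f : (B →ᵇ ℝ) →L[ℝ] ℝ, (∀ g : B →ᵇ ℝ, (∀ q, 0 ≤ g q) → 0 ≤ f g) ∧
      0 < f (BoundedContinuousFunction.const B 1) ∧
      ∀ a, ‖T a‖ ^ p * f (BoundedContinuousFunction.const B 1) ≤ C ^ p * f (N a) := by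
  have hp0 : 0 < p := by linarith
  set g : E → (B →ᵇ ℝ) := fun a =>
    (C ^ p) • N a - (‖T a‖ ^ p) • BoundedContinuousFunction.const B 1 with hg
  have hgq : ∀ a q, g a q = C ^ p * ‖ev q a‖ ^ p - ‖T a‖ ^ p := by
    intro a q; simp [hg, hN]
  have hscale : ∀ t : ℝ, 0 ≤ t → ∀ a, g (((t ^ (1 / p) : ℝ) : 𝕜) • a) = t • g a := by
    intro t ht a
    ext q
    have h1 : (t ^ (1 / p)) ^ p = t := by
      rw [← Real.rpow_mul ht, one_div, inv_mul_cancel₀ hp0.ne', Real.rpow_one]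
    have h2 : ‖((t ^ (1 / p) : ℝ) : 𝕜)‖ = t ^ (1 / p) := by
      rw [RCLike.norm_ofReal, abs_of_nonneg (Real.rpow_nonneg ht _)]
    simp only [BoundedContinuousFunction.coe_smul, smul_eq_mul]
    rw [hgq, hgq, map_smul, map_smul, norm_smul, norm_smul, h2,
      Real.mul_rpow (Real.rpow_nonneg ht _) (norm_nonneg _),
      Real.mul_rpow (Real.rpow_nonneg ht _) (norm_nonneg _), h1]
    ring
  obtain ⟨f, hf1, hf2, hf3⟩ := positive_functional (Set.range g) ⟨g 0, 0, rfl⟩ (by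
    rintro t ht _ ⟨a, rfl⟩
    exact ⟨_, hscale t ht a⟩) (by
    intro G hG ε hε
    obtain ⟨ι, _, w, z, hw, -, hz, rfl⟩ := mem_convexHull_iff_exists_fintype.1 hG
    choose a ha using hz
    set b : ι → E := fun j => (((w j) ^ (1 / p) : ℝ) : 𝕜) • a j with hb
    have hsum : ∑ j, w j • z j = ∑ j, g (b j) := by
      refine Finset.sum_congr rfl fun j _ => ?_
      rw [hb, hscale _ (hw j), ha]
    have hsumq : ∀ q, (∑ j, w j • z j) q = C ^ p * ∑ j, ‖ev q (b j)‖ ^ p - ∑ j, ‖T (b j)‖ ^ p := by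
      intro q
      rw [hsum, BoundedContinuousFunction.sum_apply, Finset.mul_sum, ← Finset.sum_sub_distrib]
      exact Finset.sum_congr rfl fun j _ => hgq _ _
    by_contra! hcon
    simp only [hsumq] at hcon
    have hS0 : ∀ q, 0 ≤ ∑ j, ‖ev q (b j)‖ ^ p := fun q =>
      Finset.sum_nonneg fun j _ => Real.rpow_nonneg (norm_nonneg _) _
    set L := ∑ j, ‖T (b j)‖ ^ p with hL
    have hL0 : 0 ≤ L - ε := by
      obtain ⟨q⟩ := ‹Nonempty B›
      have := mul_nonneg (Real.rpow_nonneg hC p) (hS0 q)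
      linarith [hcon q]
    have h1 := h ι b
    rw [Real.mul_iSup_of_nonneg hC] at h1
    have h2 : (⨆ q : B, C * (∑ j, ‖ev q (b j)‖ ^ p) ^ (1 / p)) ≤ (L - ε) ^ (1 / p) := by
      refine ciSup_le fun q => ?_
      have h3 : C = (C ^ p) ^ (1 / p) := by
        rw [← Real.rpow_mul hC, one_div, mul_inv_cancel₀ hp0.ne', Real.rpow_one]
      rw [h3, ← Real.mul_rpow (Real.rpow_nonneg hC _) (hS0 q)]
      exact Real.rpow_le_rpow (mul_nonneg (Real.rpow_nonneg hC p) (hS0 q))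
        (by linarith [hcon q]) (by positivity)
    have h4 : (L - ε) ^ (1 / p) < L ^ (1 / p) :=
      Real.rpow_lt_rpow hL0 (by linarith) (by positivity)
    linarith)
  refine ⟨f, hf1, hf3, fun a => ?_⟩
  have := hf2 (g a) ⟨a, rfl⟩
  rw [hg] at this
  simp only [map_sub, map_smul, smul_eq_mul] at this
  linarith

theorem rpow_le_aux {p t η : ℝ} (hp : 1 ≤ p) (ht : 0 ≤ t) (ht2 : t ≤ 2) (hη : 0 < η) :
    t ^ p ≤ η ^ p + 2 ^ p / η ^ 2 * t ^ 2 := by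
  have h0 : 0 ≤ η ^ p := by positivity
  have h1 : 0 ≤ 2 ^ p / η ^ 2 * t ^ 2 := by positivity
  rcases le_total t η with h | h
  · have := Real.rpow_le_rpow ht h (by linarith : 0 ≤ p)
    linarith
  · have h2 := Real.rpow_le_rpow ht ht2 (by linarith : 0 ≤ p)
    have h3 : (2:ℝ) ^ p ≤ 2 ^ p / η ^ 2 * t ^ 2 := by
      rw [div_mul_eq_mul_div, le_div_iff₀ (by positivity)]
      gcongr
    linarith

theorem abstract_weak_limit {𝕜 : Type*} [RCLike 𝕜] {Y B I : Type*}
    [NormedAddCommGroup Y] [NormedSpace 𝕜 Y] [CompleteSpace Y] [Nonempty B]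
    (P : I → Y) (R : ℝ) (hR : ∀ x, ‖P x‖ ≤ R) (e : B → I → 𝕜) (he : ∀ q x, ‖e q x‖ ≤ 1)
    {p C : ℝ} (hp : 1 ≤ p) (hC : 0 ≤ C)
    (h : ∀ (ι : Type) [Fintype ι] (a : ι → (I →₀ 𝕜)),
      (∑ j, ‖Finsupp.linearCombination 𝕜 P (a j)‖ ^ p) ^ (1 / p) ≤
        C * ⨆ q : B, (∑ j, ‖Finsupp.linearCombination 𝕜 (e q) (a j)‖ ^ p) ^ (1 / p))
    (V : Ultrafilter I) :
    ∃ y : Y, ∀ φ : Y →L[𝕜] 𝕜, Tendsto (fun x => φ (P x)) V (𝓝 (φ y)) := by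
  letI : TopologicalSpace B := ⊥
  haveI : DiscreteTopology B := ⟨rfl⟩
  have hp0 : 0 < p := by linarith
  set T := Finsupp.linearCombination 𝕜 P with hT
  set ev : B → (I →₀ 𝕜) →ₗ[𝕜] 𝕜 := fun q => Finsupp.linearCombination 𝕜 (e q) with hev
  have hb : ∀ a q, ‖ev q a‖ ≤ ∑ x ∈ a.support, ‖a x‖ := by
    intro a q
    rw [hev]
    simp only [Finsupp.linearCombination_apply, Finsupp.sum]
    refine (norm_sum_le _ _).trans (Finset.sum_le_sum fun x _ => ?_)
    rw [norm_smul]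
    exact mul_le_of_le_one_right (norm_nonneg _) (he q x)
  set N : (I →₀ 𝕜) → (B →ᵇ ℝ) := fun a =>
    BoundedContinuousFunction.ofNormedAddCommGroupDiscrete (fun q => ‖ev q a‖ ^ p)
      ((∑ x ∈ a.support, ‖a x‖) ^ p) (fun q => by
        rw [Real.norm_of_nonneg (Real.rpow_nonneg (norm_nonneg _) _)]
        exact Real.rpow_le_rpow (norm_nonneg _) (hb a q) hp0.le) with hN
  set S : (I →₀ 𝕜) → (B →ᵇ ℝ) := fun a =>
    BoundedContinuousFunction.ofNormedAddCommGroupDiscrete (fun q => ‖ev q a‖ ^ 2)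
      ((∑ x ∈ a.support, ‖a x‖) ^ 2) (fun q => by
        rw [Real.norm_of_nonneg (by positivity)]
        exact pow_le_pow_left₀ (norm_nonneg _) (hb a q) 2) with hS
  have hSq : ∀ a q, S a q = ‖ev q a‖ ^ 2 := fun a q => rfl
  have hNq : ∀ a q, N a q = ‖ev q a‖ ^ p := fun a q => rfl
  obtain ⟨f, hf1, hf2, hf3⟩ := exists_domination T ev hp hC N hNq h
  set o : B →ᵇ ℝ := BoundedContinuousFunction.const B 1 with ho
  have hoq : ∀ q, o q = 1 := fun q => rfl
  have hmono : ∀ g g' : B →ᵇ ℝ, (∀ q, g q ≤ g' q) → f g ≤ f g' := by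
    intro g g' hgg
    have := hf1 (g' - g) (fun q => by simpa using hgg q)
    rw [map_sub] at this
    linarith
  set δ : I → (I →₀ 𝕜) := fun x => Finsupp.single x 1 with hδ
  have hTδ : ∀ x, T (δ x) = P x := by intro x; simp [hT, hδ]
  have hconv : ∀ a ∈ convexHull ℝ (Set.range δ), ∀ q, ‖ev q a‖ ≤ 1 := by
    intro a ha q
    have : convexHull ℝ (Set.range δ) ⊆
        ((ev q).restrictScalars ℝ) ⁻¹' Metric.closedBall 0 1 := by
      refine convexHull_min ?_ ((convex_closedBall 0 1).linear_preimage _)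
      rintro _ ⟨x, rfl⟩
      simpa [hev, hδ] using he q x
    simpa using this ha
  have main := weak_limit δ T R (fun x => by rw [hTδ]; exact hR x) (fun a => f (S a))
    (fun a => hf1 _ fun q => by rw [hSq]; positivity) (f o)
    (fun a ha => hmono _ _ fun q => by
      rw [hSq, hoq]
      exact pow_le_one₀ (norm_nonneg _) (hconv a ha q))
    (by
      intro a b
      have : S (a - b) = (2:ℝ) • S a + (2:ℝ) • S b -
          (4:ℝ) • S ((1 / 2 : ℝ) • a + (1 / 2 : ℝ) • b) := by
        ext q
        have e1 : ev q ((1 / 2 : ℝ) • a + (1 / 2 : ℝ) • b) = (1 / 2 : ℝ) • (ev q a + ev q b) := by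
          have := map_add ((ev q).restrictScalars ℝ) ((1 / 2 : ℝ) • a) ((1 / 2 : ℝ) • b)
          rw [map_smul, map_smul] at this
          rw [smul_add]
          exact this
        have e2 := parallelogram_law_with_norm 𝕜 (ev q a) (ev q b)
        simp only [BoundedContinuousFunction.coe_sub, BoundedContinuousFunction.coe_add,
          BoundedContinuousFunction.coe_smul, Pi.sub_apply, Pi.add_apply, hSq, smul_eq_mul]
        rw [e1, map_sub, norm_smul, Real.norm_of_nonneg (by norm_num)]
        nlinarith
      rw [this]
      simp only [map_sub, map_add, map_smul, smul_eq_mul])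
    (by
      intro ε hε
      -- choose the truncation level
      set c := f o with hc
      have hCp : 0 ≤ C ^ p := Real.rpow_nonneg hC p
      obtain ⟨η, hη, hηε⟩ : ∃ η > 0, C ^ p * η ^ p < ε ^ p / 2 := by
        refine ⟨ε / (4 * (C + 1)), by positivity, ?_⟩
        rw [← Real.mul_rpow hC (by positivity)]
        have h1 : C * (ε / (4 * (C + 1))) ≤ ε * (1 / 4) := by
          rw [mul_div_assoc', div_le_iff₀ (by positivity)]
          nlinarith
        have h2 := Real.rpow_le_rpow (by positivity) h1 hp0.le
        rw [Real.mul_rpow hε.le (by norm_num)] at h2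
        have h3 : (1 / 4 : ℝ) ^ p ≤ (1 / 4 : ℝ) ^ (1 : ℝ) :=
          Real.rpow_le_rpow_of_exponent_ge (by norm_num) (by norm_num) hp
        rw [Real.rpow_one] at h3
        have h4 : 0 < ε ^ p := by positivity
        nlinarith
      set D := C ^ p * (2 ^ p / η ^ 2) with hD
      have hD0 : 0 ≤ D := by positivity
      have hεp : 0 < ε ^ p := by positivity
      refine ⟨c * (ε ^ p / 2) / (D + 1), by positivity, fun a ha b hb hab => ?_⟩
      have hle : ∀ q, ‖ev q (a - b)‖ ≤ 2 := by
        intro q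
        rw [map_sub]
        have := norm_sub_le (ev q a) (ev q b)
        linarith [hconv a ha q, hconv b hb q]
      have h1 : f (N (a - b)) ≤ η ^ p * c + 2 ^ p / η ^ 2 * f (S (a - b)) := by
        have := hmono (N (a - b)) ((η ^ p) • o + (2 ^ p / η ^ 2) • S (a - b)) (fun q => by
          simp only [BoundedContinuousFunction.coe_add,
            BoundedContinuousFunction.coe_smul, Pi.add_apply, hSq, hNq, hoq, smul_eq_mul, mul_one]
          exact rpow_le_aux hp (norm_nonneg _) (hle q) hη)
        simpa only [map_add, map_smul, smul_eq_mul] using this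
      have h2 := hf3 (a - b)
      have h3 : C ^ p * f (N (a - b)) ≤ C ^ p * η ^ p * c + D * f (S (a - b)) := by
        have := mul_le_mul_of_nonneg_left h1 hCp
        rw [hD]
        linarith
      rw [lt_div_iff₀ (by positivity)] at hab
      have hSn : 0 ≤ f (S (a - b)) := hf1 _ fun q => by rw [hSq]; positivity
      have h4 : C ^ p * η ^ p * c < ε ^ p / 2 * c := mul_lt_mul_of_pos_right hηε hf2
      have h5 : ‖T (a - b)‖ ^ p * c < ε ^ p * c := by nlinarith
      have h6 : ‖T (a - b)‖ ^ p < ε ^ p := lt_of_mul_lt_mul_right h5 hf2.le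
      exact (Real.rpow_lt_rpow_iff (norm_nonneg _) hε.le hp0).1 h6) V
  simpa only [hTδ] using main

end Proof

/-- every factorable strongly `p`-summing `m`-homogeneous polynomial
`P : X → Y` between Banach spaces is weakly compact: the image of the closed unit ball
of `X` has compact closure in `Y` with its weak topology. -/
theorem factStronglySummingPoly_weaklyCompact
    {𝕜 : Type*} [RCLike 𝕜] {X Y : Type*}
    [NormedAddCommGroup X] [NormedSpace 𝕜 X] [CompleteSpace X]
    [NormedAddCommGroup Y] [NormedSpace 𝕜 Y] [CompleteSpace Y]
    (m : ℕ) (p : ℝ) (hp : 1 ≤ p) (P : X → Y)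
    (hP : FactStronglySummingPoly 𝕜 m p P) :
    IsCompact (closure ((fun x => toWeakSpace 𝕜 Y (P x)) '' Metric.closedBall 0 1)) := by
  obtain ⟨hpoly, C, hC⟩ := hP
  have himg : (fun x => toWeakSpace 𝕜 Y (P x)) '' Metric.closedBall 0 1 =
      Set.range fun x : {x : X // ‖x‖ ≤ 1} => toWeakSpace 𝕜 Y (P x.1) := by
    ext y
    simp
  rw [himg]
  obtain ⟨R, hR⟩ := homogPoly_bounded hpoly
  refine isCompact_closure_range_of_ultrafilter _ fun V => ?_
  haveI : Nonempty {q : X → 𝕜 // IsHomogPoly 𝕜 m q ∧ polyNorm q ≤ 1} :=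
    ⟨⟨fun _ => 0, ⟨0, fun _ => rfl⟩, by simp [polyNorm]⟩⟩
  obtain ⟨y, hy⟩ := abstract_weak_limit (𝕜 := 𝕜)
    (B := {q : X → 𝕜 // IsHomogPoly 𝕜 m q ∧ polyNorm q ≤ 1})
    (fun x : {x : X // ‖x‖ ≤ 1} => P x.1) R hR (fun q x => q.1 x.1)
    (fun q x => (homogPoly_le_polyNorm q.2.1 x).trans q.2.2) hp hC.1
    (fun ι _ a => finsupp_bound hC a) V
  refine ⟨toWeakSpace 𝕜 Y y, ?_⟩
  change Filter.Tendsto _ _ (@nhds _ (TopologicalSpace.induced _ _) _)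
  rw [nhds_induced, Filter.tendsto_comap_iff, tendsto_pi_nhds]
  exact hy
end

section
/- Let 1 ≤ p < ∞. Every factorable strongly p-summing continuous n-linear operator T : X_1 × ⋯ × X_n → Y between Banach spaces is weakly compact, i.e., the image T(B_{X_1} × ⋯ × B_{X_n}) of the product of the closed unit balls has compact closure in Y endowed with its weak topology. -/
open scoped BigOperators
open MeasureTheory

open Filter Topology in
/-- Dyadic trees with large differences, built along a filter converging to a non-evaluation
element of the bidual. -/
theorem fss_tree {𝕜 : Type*} [RCLike 𝕜] {A Y : Type*} [NormedAddCommGroup Y] [NormedSpace 𝕜 Y]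
    (U : Filter A) [U.NeBot] (T : A → Y) (F : StrongDual 𝕜 (StrongDual 𝕜 Y))
    (hF : ∀ g : StrongDual 𝕜 Y, Tendsto (fun x => g (T x)) U (𝓝 (F g)))
    (δ : ℝ) (hδ : 0 < δ)
    (hd : ∀ y : Y, δ < ‖F - NormedSpace.inclusionInDoubleDual 𝕜 Y y‖) (k : ℕ) :
    ∀ V ∈ U, ∃ (ι : Type) (_ : Fintype ι) (w : ι → ℝ) (d : ι → A →₀ 𝕜) (c : A →₀ 𝕜),
      (∀ j, 0 ≤ w j) ∧ ∑ j, w j = k ∧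
      (∀ j, δ ≤ ‖Finsupp.linearCombination 𝕜 T (d j)‖) ∧
      (∀ (g : A → 𝕜) (z : 𝕜) (r : ℝ), (∀ x ∈ V, ‖g x - z‖ ≤ r) →
        ‖Finsupp.linearCombination 𝕜 g c - z‖ ≤ r) ∧
      (∀ g : A → 𝕜, (∀ x ∈ V, ‖g x‖ ≤ 1) →
        (∀ j, ‖Finsupp.linearCombination 𝕜 g (d j)‖ ≤ 2) ∧
        ‖Finsupp.linearCombination 𝕜 g c‖ ^ 2 +
          1 / 4 * ∑ j, w j * ‖Finsupp.linearCombination 𝕜 g (d j)‖ ^ 2 ≤ 1) := by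
  induction k with
  | zero =>
    intro V hV
    obtain ⟨x, hx⟩ := U.nonempty_of_mem hV
    refine ⟨Empty, inferInstance, fun _ => 0, fun _ => 0, Finsupp.single x 1, ?_, ?_, ?_, ?_, ?_⟩
    · simp
    · simp
    · rintro ⟨⟩
    · intro g z r h
      simpa using h x hx
    · intro g h
      refine ⟨by rintro ⟨⟩, ?_⟩
      simpa using h x hx
  | succ k ih =>
    intro V hV
    obtain ⟨ι₁, _, w₁, d₁, c₁, hw₁, hs₁, hd₁, hc₁, hg₁⟩ := ih V hV
    obtain ⟨g₀, hg₀⟩ : ∃ g : StrongDual 𝕜 Y, δ * ‖g‖ <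
        ‖F g - g (Finsupp.linearCombination 𝕜 T c₁)‖ := by
      by_contra! hcon
      exact absurd (ContinuousLinearMap.opNorm_le_bound _ hδ.le hcon)
        (not_le.2 (hd (Finsupp.linearCombination 𝕜 T c₁)))
    set y := Finsupp.linearCombination 𝕜 T c₁ with hy
    set r := ‖F g₀ - g₀ y‖ - δ * ‖g₀‖ with hr
    have hr0 : 0 < r := by linarith
    have hV' : V ∩ {x | ‖g₀ (T x) - F g₀‖ ≤ r} ∈ U := by
      refine inter_mem hV ?_
      filter_upwards [(hF g₀) (Metric.closedBall_mem_nhds _ hr0)] with x hx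
      simpa [dist_eq_norm] using hx
    obtain ⟨ι₂, _, w₂, d₂, c₂, hw₂, hs₂, hd₂, hc₂, hg₂⟩ := ih _ hV'
    have hc₂' : ∀ (g : A → 𝕜) (z : 𝕜) (r : ℝ), (∀ x ∈ V, ‖g x - z‖ ≤ r) →
        ‖Finsupp.linearCombination 𝕜 g c₂ - z‖ ≤ r :=
      fun g z r h => hc₂ g z r fun x hx => h x hx.1
    have hg₂' := fun (g : A → 𝕜) (h : ∀ x ∈ V, ‖g x‖ ≤ 1) => hg₂ g fun x hx => h x hx.1
    refine ⟨Option (ι₁ ⊕ ι₂), inferInstance,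
      fun o => o.elim 1 (Sum.elim (fun j => w₁ j / 2) (fun j => w₂ j / 2)),
      fun o => o.elim (c₁ - c₂) (Sum.elim d₁ d₂), (2⁻¹ : 𝕜) • (c₁ + c₂), ?_, ?_, ?_, ?_, ?_⟩
    · rintro (_ | j | j)
      · simp
      · simpa using div_nonneg (hw₁ j) two_pos.le
      · simpa using div_nonneg (hw₂ j) two_pos.le
    · simp only [Fintype.sum_option, Fintype.sum_sum_type, Option.elim, Sum.elim_inl, Sum.elim_inr,
        ← Finset.sum_div, hs₁, hs₂]
      push_cast
      ring
    · rintro (_ | j | j)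
      · simp only [Option.elim, map_sub, ← hy]
        have h1 : ‖g₀ (Finsupp.linearCombination 𝕜 T c₂) - F g₀‖ ≤ r := by
          have h2 := hc₂ (fun x => g₀ (T x)) (F g₀) r (fun x hx => hx.2)
          have h3 : Finsupp.linearCombination 𝕜 (fun x => g₀ (T x)) c₂ =
              g₀ (Finsupp.linearCombination 𝕜 T c₂) := by
            simp [Finsupp.linearCombination_apply, Finsupp.sum]
          rwa [h3] at h2
        have h4 : ‖F g₀ - g₀ y‖ ≤ ‖g₀ (Finsupp.linearCombination 𝕜 T c₂) - F g₀‖ +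
            ‖g₀ (y - Finsupp.linearCombination 𝕜 T c₂)‖ := by
          have h8 := norm_add_le (g₀ (Finsupp.linearCombination 𝕜 T c₂) - F g₀)
            (g₀ (y - Finsupp.linearCombination 𝕜 T c₂))
          rw [norm_sub_rev]
          refine le_trans (le_of_eq ?_) h8
          rw [map_sub]
          congr 1
          ring
        have h5 := g₀.le_opNorm (y - Finsupp.linearCombination 𝕜 T c₂)
        have h6 : δ * ‖g₀‖ ≤ ‖y - Finsupp.linearCombination 𝕜 T c₂‖ * ‖g₀‖ := by
          nlinarith
        have h7 : 0 < ‖g₀‖ := by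
          rw [norm_pos_iff]
          rintro rfl
          simp at hg₀
        exact le_of_mul_le_mul_right h6 h7
      · exact hd₁ j
      · exact hd₂ j
    · intro g z r h
      have e1 := hc₁ g z r h
      have e2 := hc₂' g z r h
      simp only [map_smul, map_add, smul_eq_mul]
      have : (2⁻¹ : 𝕜) * (Finsupp.linearCombination 𝕜 g c₁ + Finsupp.linearCombination 𝕜 g c₂) - z
          = 2⁻¹ * ((Finsupp.linearCombination 𝕜 g c₁ - z) +
            (Finsupp.linearCombination 𝕜 g c₂ - z)) := by
        field_simp
        ring
      rw [this, norm_mul, norm_inv, RCLike.norm_ofNat]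
      have := norm_add_le (Finsupp.linearCombination 𝕜 g c₁ - z)
        (Finsupp.linearCombination 𝕜 g c₂ - z)
      linarith
    · intro g h
      obtain ⟨a1, a2⟩ := hg₁ g h
      obtain ⟨b1, b2⟩ := hg₂' g h
      have e1 := hc₁ g 0 1 (by simpa using h)
      have e2 := hc₂' g 0 1 (by simpa using h)
      rw [sub_zero] at e1 e2
      refine ⟨?_, ?_⟩
      · rintro (_ | j | j)
        · simp only [Option.elim, map_sub]
          exact (norm_sub_le _ _).trans (by linarith)
        · exact a1 j
        · exact b1 j
      · simp only [Fintype.sum_option, Fintype.sum_sum_type, Option.elim, Sum.elim_inl,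
          Sum.elim_inr, map_sub, map_smul, map_add, smul_eq_mul, norm_mul, norm_inv,
          RCLike.norm_ofNat, div_mul_eq_mul_div, ← Finset.sum_div]
        have := parallelogram_law_with_norm 𝕜 (Finsupp.linearCombination 𝕜 g c₁)
          (Finsupp.linearCombination 𝕜 g c₂)
        nlinarith

/-- Absorbing the weights into the coefficients. -/
theorem fss_key {𝕜 : Type*} [RCLike 𝕜] {A Z : Type*} [NormedAddCommGroup Z] [NormedSpace 𝕜 Z]
    (p : ℝ) (hp0 : 0 < p) (s : Finset A) {m : ℕ} (e : Fin m ≃ s) (d : A →₀ 𝕜)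
    (hds : d.support ⊆ s) (w : ℝ) (hw : 0 ≤ w) (g : A → Z) :
    ‖∑ i, ((w ^ (1 / p) : ℝ) : 𝕜) • d (e i) • g (e i)‖ ^ p =
      w * ‖Finsupp.linearCombination 𝕜 g d‖ ^ p := by
  have h1 : ∑ i, d (e i) • g (e i) = Finsupp.linearCombination 𝕜 g d := by
    rw [Finsupp.linearCombination_apply, Finsupp.sum_of_support_subset (s := s)]
    · rw [e.sum_comp (fun a : s => d a • g a)]
      exact Finset.sum_coe_sort s (fun a => d a • g a)
    · exact hds
    · simp
  rw [← Finset.smul_sum, h1, norm_smul, RCLike.norm_ofReal,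
    abs_of_nonneg (Real.rpow_nonneg hw _), Real.mul_rpow (Real.rpow_nonneg hw _)
      (norm_nonneg _), ← Real.rpow_mul hw, one_div_mul_cancel hp0.ne', Real.rpow_one]

/-- The summing inequality for finitely supported combinations. -/
theorem fss_finsupp {𝕜 : Type*} [RCLike 𝕜] {n : ℕ} {X : Fin n → Type*} {Y : Type*}
    [∀ k, NormedAddCommGroup (X k)] [∀ k, NormedSpace 𝕜 (X k)]
    [NormedAddCommGroup Y] [NormedSpace 𝕜 Y]
    (p : ℝ) (hp : 1 ≤ p) (T : ContinuousMultilinearMap 𝕜 X Y) (C : ℝ)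
    (hT : FactStronglySummingBound 𝕜 p T C) {ι : Type} [Fintype ι] (d : ι → (∀ k, X k) →₀ 𝕜)
    (w : ι → ℝ) (hw : ∀ j, 0 ≤ w j) (R : ℝ) (hR : 0 ≤ R)
    (h : ∀ φ : ContinuousMultilinearMap 𝕜 X 𝕜, ‖φ‖ ≤ 1 →
      ∑ j, w j * ‖Finsupp.linearCombination 𝕜 φ (d j)‖ ^ p ≤ R) :
    ∑ j, w j * ‖Finsupp.linearCombination 𝕜 T (d j)‖ ^ p ≤ C ^ p * R := by
  classical
  obtain ⟨hC, hT⟩ := hT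
  have hp0 : 0 < p := by linarith
  let s : Finset (∀ k, X k) := Finset.univ.biUnion fun j => (d j).support
  let e := s.equivFin.symm
  let f := (Fintype.equivFin ι).symm
  have hsub : ∀ j, (d j).support ⊆ s := fun j =>
    Finset.subset_biUnion_of_mem (fun j => (d j).support) (Finset.mem_univ j)
  have main := hT (Fintype.card ι) (s.card) (fun _ i => (e i : ∀ k, X k))
    (fun j i => (((w (f j)) ^ (1 / p) : ℝ) : 𝕜) • d (f j) (e i))
  simp only [smul_assoc] at main
  have kT : ∀ j, ‖∑ i, (((w (f j)) ^ (1 / p) : ℝ) : 𝕜) • d (f j) (e i) • T (e i)‖ ^ p =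
        w (f j) * ‖Finsupp.linearCombination 𝕜 T (d (f j))‖ ^ p := fun j =>
    fss_key p hp0 s e (d (f j)) (hsub _) _ (hw _) T
  have kφ : ∀ (φ : ContinuousMultilinearMap 𝕜 X 𝕜) j,
      ‖∑ i, (((w (f j)) ^ (1 / p) : ℝ) : 𝕜) • d (f j) (e i) • φ (e i)‖ ^ p =
        w (f j) * ‖Finsupp.linearCombination 𝕜 φ (d (f j))‖ ^ p := fun φ j =>
    fss_key p hp0 s e (d (f j)) (hsub _) _ (hw _) φ
  simp only [kT, kφ] at main
  rw [f.sum_comp (fun j => w j * ‖Finsupp.linearCombination 𝕜 T (d j)‖ ^ p)] at main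
  have hsup : (⨆ φ : {φ : ContinuousMultilinearMap 𝕜 X 𝕜 // ‖φ‖ ≤ 1},
      (∑ j, w (f j) * ‖Finsupp.linearCombination 𝕜 φ.1 (d (f j))‖ ^ p) ^ (1 / p)) ≤
      R ^ (1 / p) := by
    have : Nonempty {φ : ContinuousMultilinearMap 𝕜 X 𝕜 // ‖φ‖ ≤ 1} := ⟨⟨0, by simp⟩⟩
    refine ciSup_le fun φ => ?_
    rw [f.sum_comp (fun j => w j * ‖Finsupp.linearCombination 𝕜 φ.1 (d j)‖ ^ p)]
    refine Real.rpow_le_rpow ?_ (h φ.1 φ.2) (by positivity)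
    exact Finset.sum_nonneg fun j _ => mul_nonneg (hw j) (by positivity)
  have h0 : 0 ≤ ∑ j, w j * ‖Finsupp.linearCombination 𝕜 T (d j)‖ ^ p :=
    Finset.sum_nonneg fun j _ => mul_nonneg (hw j) (by positivity)
  have h2 := main.trans (mul_le_mul_of_nonneg_left hsup hC)
  have h3 := Real.rpow_le_rpow (by positivity) h2 hp0.le
  rwa [Real.mul_rpow hC (by positivity), ← Real.rpow_mul h0, ← Real.rpow_mul hR,
    one_div_mul_cancel hp0.ne', Real.rpow_one, Real.rpow_one] at h3

/-- every factorable strongly `p`-summing continuous `n`-linear operator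
`T : X 1 × ⋯ × X n → Y` between Banach spaces is weakly compact: the image of the
product of the closed unit balls has compact closure in `Y` with its weak topology. -/
theorem factStronglySumming_weaklyCompact
    {𝕜 : Type*} [RCLike 𝕜] {n : ℕ} {X : Fin n → Type*} {Y : Type*}
    [∀ k, NormedAddCommGroup (X k)] [∀ k, NormedSpace 𝕜 (X k)] [∀ k, CompleteSpace (X k)]
    [NormedAddCommGroup Y] [NormedSpace 𝕜 Y] [CompleteSpace Y]
    (p : ℝ) (hp : 1 ≤ p) (T : ContinuousMultilinearMap 𝕜 X Y)
    (hT : FactStronglySumming 𝕜 p T) :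
    IsCompact (closure
      ((fun x => toWeakSpace 𝕜 Y (T x)) '' {x : ∀ k, X k | ∀ k, ‖x k‖ ≤ 1})) := by
  classical
  obtain ⟨C, hC⟩ := hT
  have hC0 : 0 ≤ C := hC.1
  have hp0 : 0 < p := by linarith
  refine NormedSpace.isCompact_closure_of_isBounded 𝕜 Y _ ?_ ?_
  · refine (Metric.isBounded_closedBall (x := (0 : Y)) (r := ‖T‖)).subset ?_
    rintro y ⟨x, hx, hxy⟩
    have : y = T x := ((toWeakSpace 𝕜 Y).injective hxy).symm
    rw [this, mem_closedBall_zero_iff]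
    have hle : ‖T x‖ ≤ ‖T‖ := T.unit_le_opNorm ((pi_norm_le_iff_of_nonneg zero_le_one).2 hx)
    exact hle
  intro F hFc
  rw [Set.image_image] at hFc
  set B : Set (∀ k, X k) := {x | ∀ k, ‖x k‖ ≤ 1} with hB
  set q : (∀ k, X k) → WeakDual 𝕜 (StrongDual 𝕜 Y) := fun x =>
    NormedSpace.inclusionInDoubleDualWeak 𝕜 Y (toWeakSpace 𝕜 Y (T x)) with hq
  let U : Filter (∀ k, X k) := Filter.comap q (nhds F) ⊓ Filter.principal B
  have hU : U.NeBot := by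
    rw [← Filter.map_neBot_iff q, Filter.push_pull', Filter.map_principal]
    exact mem_closure_iff_clusterPt.1 hFc
  have hqU : Filter.Tendsto q U (nhds F) := Filter.tendsto_comap.mono_left inf_le_left
  have hBU : B ∈ U := Filter.mem_inf_of_right (Filter.mem_principal_self B)
  let F' : StrongDual 𝕜 (StrongDual 𝕜 Y) := WeakDual.toStrongDual F
  have hF : ∀ g : StrongDual 𝕜 Y, Filter.Tendsto (fun x => g (T x)) U (nhds (F' g)) := fun g =>
    ((WeakDual.eval_continuous g).tendsto F).comp hqU
  by_contra hcon
  have hcl : IsClosed (Set.range (NormedSpace.inclusionInDoubleDualLi (E := Y) 𝕜)) :=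
    (NormedSpace.inclusionInDoubleDualLi (E := Y) 𝕜).isometry.isUniformInducing.isComplete_range.isClosed
  have hnot : F' ∉ Set.range (NormedSpace.inclusionInDoubleDualLi (E := Y) 𝕜) := by
    rintro ⟨y, hy⟩
    exact hcon ⟨toWeakSpace 𝕜 Y y, hy⟩
  obtain ⟨ε, hε, hεb⟩ := Metric.isOpen_iff.1 hcl.isOpen_compl F' hnot
  set δ := ε / 2 with hδdef
  have hδ : 0 < δ := by positivity
  have hd : ∀ y : Y, δ < ‖F' - NormedSpace.inclusionInDoubleDual 𝕜 Y y‖ := by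
    intro y
    by_contra! hle
    refine hεb (a := NormedSpace.inclusionInDoubleDual 𝕜 Y y) ?_ ⟨y, rfl⟩
    rw [Metric.mem_ball, dist_comm]
    exact (dist_eq_norm F' (NormedSpace.inclusionInDoubleDual 𝕜 Y y)).trans_lt (by linarith)
  set η := δ / (2 * (C + 1)) with hη
  have hη0 : 0 < η := by positivity
  have hCη : C ^ p * η ^ p ≤ δ ^ p / 2 := by
    rw [← Real.mul_rpow hC0 hη0.le]
    have h1 : C * η ≤ δ / 2 := by
      rw [hη, mul_div_assoc', div_le_div_iff₀ (by positivity) two_pos]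
      nlinarith
    refine (Real.rpow_le_rpow (by positivity) h1 hp0.le).trans ?_
    rw [Real.div_rpow hδ.le two_pos.le]
    have h2 : (2 : ℝ) ≤ 2 ^ p := by
      simpa using Real.rpow_le_rpow_of_exponent_le (one_le_two (α := ℝ)) hp
    exact div_le_div_of_nonneg_left (by positivity) two_pos h2
  set M := (2 : ℝ) ^ p / η ^ 2 with hM
  have hM0 : 0 < M := by positivity
  have hpt : ∀ t : ℝ, 0 ≤ t → t ≤ 2 → t ^ p ≤ η ^ p + M * t ^ 2 := by
    intro t ht0 ht2
    rcases le_total t η with h | h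
    · have := Real.rpow_le_rpow ht0 h hp0.le
      have : 0 ≤ M * t ^ 2 := by positivity
      linarith
    · have h1 := Real.rpow_le_rpow ht0 ht2 hp0.le
      have h2 : (2 : ℝ) ^ p ≤ M * t ^ 2 := by
        rw [hM, div_mul_eq_mul_div, le_div_iff₀ (by positivity)]
        have : η ^ 2 ≤ t ^ 2 := pow_le_pow_left₀ hη0.le h 2
        exact mul_le_mul_of_nonneg_left this (by positivity)
      have : 0 ≤ η ^ p := by positivity
      linarith
  have hδp : 0 < δ ^ p := by positivity
  obtain ⟨k, hk⟩ := exists_nat_gt (C ^ p * (4 * M) / (δ ^ p / 2))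
  rw [div_lt_iff₀ (by positivity)] at hk
  obtain ⟨ι, _, w, d, c, hw, hs, hdj, -, hg⟩ := fss_tree U T F' hF δ hδ hd k B hBU
  have hfin := fss_finsupp p hp T C hC d w hw (η ^ p * k + 4 * M) (by positivity) (by
    intro φ hφ
    obtain ⟨g1, g2⟩ := hg φ (fun x hx =>
      (φ.unit_le_opNorm ((pi_norm_le_iff_of_nonneg zero_le_one).2 hx)).trans hφ)
    have h4 : ∑ j, w j * ‖Finsupp.linearCombination 𝕜 φ (d j)‖ ^ 2 ≤ 4 := by
      nlinarith [sq_nonneg ‖Finsupp.linearCombination 𝕜 φ c‖]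
    calc ∑ j, w j * ‖Finsupp.linearCombination 𝕜 φ (d j)‖ ^ p
        ≤ ∑ j, (w j * η ^ p + M * (w j * ‖Finsupp.linearCombination 𝕜 φ (d j)‖ ^ 2)) := by
          refine Finset.sum_le_sum fun j _ => ?_
          have := mul_le_mul_of_nonneg_left (hpt _ (norm_nonneg _) (g1 j)) (hw j)
          linarith
      _ = η ^ p * k + M * ∑ j, w j * ‖Finsupp.linearCombination 𝕜 φ (d j)‖ ^ 2 := by
          rw [Finset.sum_add_distrib, ← Finset.sum_mul, hs, ← Finset.mul_sum, mul_comm]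
      _ ≤ η ^ p * k + 4 * M := by nlinarith)
  have hlow : k * δ ^ p ≤ ∑ j, w j * ‖Finsupp.linearCombination 𝕜 T (d j)‖ ^ p := by
    rw [← hs, Finset.sum_mul]
    exact Finset.sum_le_sum fun j _ =>
      mul_le_mul_of_nonneg_left (Real.rpow_le_rpow hδ.le (hdj j) hp0.le) (hw j)
  have hk0 : (0 : ℝ) ≤ k := k.cast_nonneg
  have := mul_le_mul_of_nonneg_right hCη hk0
  nlinarith
end

section
/- (Dvoretzky–Rogers type theorem) Let Y be a Banach space, n a positive integer and 1 ≤ p < ∞. Every continuous n-linear operator T : Y × ⋯ × Y → Y is factorable strongly p-summing if and only if Y is finite-dimensional. -/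
open scoped BigOperators
open MeasureTheory

/-- A weighted form of the summing inequality. -/
def DRWeighted (𝕜 : Type*) [RCLike 𝕜] (E : Type*) [NormedAddCommGroup E] [NormedSpace 𝕜 E]
    (D : ℝ) : Prop :=
  ∀ (m : ℕ) (y : Fin m → E) (w : Fin m → ℝ), (∀ j, ‖y j‖ = 1) → (∀ j, 0 ≤ w j) →
    0 < ∑ j, w j → ∃ φ : E →L[𝕜] 𝕜, ‖φ‖ ≤ 1 ∧ ∑ j, w j < D * ∑ j, w j * ‖φ (y j)‖

theorem DRWeighted.submodule {𝕜 : Type*} [RCLike 𝕜] {E : Type*} [NormedAddCommGroup E]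
    [NormedSpace 𝕜 E] {D : ℝ} (h : DRWeighted 𝕜 E D) (F : Submodule 𝕜 E) :
    DRWeighted 𝕜 F D := by
  intro m y w hy hw hW
  obtain ⟨φ, h1, h2⟩ := h m (fun j => (y j : E)) w (fun j => by simpa using hy j) hw hW
  refine ⟨φ.comp F.subtypeL, ?_, by simpa using h2⟩
  refine ContinuousLinearMap.opNorm_le_bound _ zero_le_one fun x => ?_
  have := φ.le_of_opNorm_le h1 (x : E)
  simpa using this

/-- Finite Pietsch domination. -/
theorem DRWeighted.pietsch {𝕜 : Type*} [RCLike 𝕜] {E : Type*} [NormedAddCommGroup E]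
    [NormedSpace 𝕜 E] {D : ℝ} (h : DRWeighted 𝕜 E D) (m : ℕ) (y : Fin m → E)
    (hy : ∀ j, ‖y j‖ = 1) :
    ∃ (ι : Type) (_ : Fintype ι) (c : ι → ℝ) (φ : ι → E →L[𝕜] 𝕜), (∀ l, 0 ≤ c l) ∧
      ∑ l, c l = 1 ∧ (∀ l, ‖φ l‖ ≤ 1) ∧ ∀ j, 1 < D * ∑ l, c l * ‖φ l (y j)‖ := by
  classical
  let v : {φ : E →L[𝕜] 𝕜 // ‖φ‖ ≤ 1} → (Fin m → ℝ) := fun φ j => D * ‖φ.1 (y j)‖ - 1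
  let s : Set (Fin m → ℝ) := Set.univ.pi fun _ => Set.Ioi 0
  by_cases hd : Disjoint s (convexHull ℝ (Set.range v))
  · exfalso
    have hso : IsOpen s := isOpen_set_pi Set.finite_univ fun _ _ => isOpen_Ioi
    have hsc : Convex ℝ s := convex_pi fun _ _ => convex_Ioi 0
    obtain ⟨f, u, hfs, hft⟩ := geometric_hahn_banach_open hsc hso (convex_convexHull ℝ _) hd
    have hf : ∀ a : Fin m → ℝ, f a = ∑ j, a j * f (Pi.single j 1) := by
      intro a
      conv_lhs => rw [pi_eq_sum_univ' a]
      rw [map_sum]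
      refine Finset.sum_congr rfl fun j _ => ?_
      rw [map_smul, smul_eq_mul]
    have hone : ∀ t : ℝ, 0 < t → ∀ b : Fin m → ℝ, (∀ j, 0 ≤ b j) →
        f b + t * f (fun _ => 1) < u := by
      intro t ht b hb
      have := hfs (b + t • (fun _ => 1)) (by
        intro j _
        have := hb j
        simp only [Pi.add_apply, Pi.smul_apply, smul_eq_mul, mul_one, Set.mem_Ioi]
        linarith)
      simpa using this
    have hle : ∀ b : Fin m → ℝ, (∀ j, 0 ≤ b j) → f b ≤ u := by
      intro b hb
      have hc : Filter.Tendsto (fun t : ℝ => f b + t * f (fun _ => 1)) (nhdsWithin 0 (Set.Ioi 0))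
          (nhds (f b + 0 * f (fun _ => 1))) := by
        apply Filter.Tendsto.mono_left _ nhdsWithin_le_nhds
        exact (Continuous.tendsto (by fun_prop) 0)
      have := le_of_tendsto hc (by
        filter_upwards [self_mem_nhdsWithin] with t ht
        exact (hone t ht b hb).le)
      simpa using this
    have hu : 0 ≤ u := by simpa using hle 0 (fun _ => le_rfl)
    have hw : ∀ j, f (Pi.single j 1) ≤ 0 := by
      intro j
      by_contra hpos
      push Not at hpos
      have := hle (((u + 1) / f (Pi.single j 1)) • Pi.single j 1) (by
        intro i
        simp only [Pi.smul_apply, smul_eq_mul, Pi.single_apply]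
        split_ifs
        · positivity
        · simp)
      rw [map_smul, smul_eq_mul, div_mul_cancel₀ _ hpos.ne'] at this
      linarith
    have hmem : ∀ φ, u ≤ f (v φ) := fun φ => hft _ (subset_convexHull ℝ _ ⟨φ, rfl⟩)
    have hW : 0 < ∑ j, -f (Pi.single j 1) := by
      refine lt_of_le_of_ne (Finset.sum_nonneg fun j _ => neg_nonneg.2 (hw j)) fun h0 => ?_
      have hz := (Finset.sum_eq_zero_iff_of_nonneg
        (fun j _ => neg_nonneg.2 (hw j))).1 h0.symm
      have hf0 : ∀ a, f a = 0 := fun a => by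
        rw [hf]
        refine Finset.sum_eq_zero fun j hj => ?_
        rw [neg_eq_zero.1 (hz j hj), mul_zero]
      have h1 := hmem ⟨0, by simp⟩
      have h2 := hone 1 one_pos 0 (fun _ => le_rfl)
      simp only [hf0] at h1 h2
      linarith
    obtain ⟨φ, hφ, hφ2⟩ := h m y (fun j => -f (Pi.single j 1)) hy
      (fun j => neg_nonneg.2 (hw j)) hW
    have h1 := hmem ⟨φ, hφ⟩
    rw [hf] at h1
    have h2 : ∑ j, v ⟨φ, hφ⟩ j * f (Pi.single j 1) =
        ∑ j, -f (Pi.single j 1) - D * ∑ j, -f (Pi.single j 1) * ‖φ (y j)‖ := by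
      rw [Finset.mul_sum, ← Finset.sum_sub_distrib]
      refine Finset.sum_congr rfl fun j _ => ?_
      simp only [v]
      ring
    linarith
  · rw [Set.not_disjoint_iff] at hd
    obtain ⟨a, has, hat⟩ := hd
    obtain ⟨ι, _, c, z, hc, hc1, hz, hza⟩ := mem_convexHull_iff_exists_fintype.1 hat
    choose φ hφ using hz
    refine ⟨ι, inferInstance, c, fun l => (φ l).1, hc, hc1, fun l => (φ l).2, fun j => ?_⟩
    have h1 : 0 < a j := has j trivial
    have h2 : a j = D * ∑ l, c l * ‖(φ l).1 (y j)‖ - 1 := by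
      have h3 : D * ∑ l, c l * ‖(φ l).1 (y j)‖ - 1 =
          D * ∑ l, c l * ‖(φ l).1 (y j)‖ - ∑ l, c l := by rw [hc1]
      rw [← hza, h3, Finset.mul_sum, ← Finset.sum_sub_distrib, Finset.sum_apply]
      refine Finset.sum_congr rfl fun l _ => ?_
      rw [← hφ]
      simp only [v, Pi.smul_apply, smul_eq_mul]
      ring
    linarith

/-- Domination on the whole finite-dimensional space. -/
theorem DRWeighted.domination {𝕜 : Type*} [RCLike 𝕜] {E : Type*} [NormedAddCommGroup E]
    [NormedSpace 𝕜 E] [FiniteDimensional 𝕜 E] {D : ℝ} (hD : 0 < D) (h : DRWeighted 𝕜 E D) :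
    ∃ (ι : Type) (_ : Fintype ι) (c : ι → ℝ) (φ : ι → E →L[𝕜] 𝕜), (∀ l, 0 ≤ c l) ∧
      ∑ l, c l = 1 ∧ (∀ l, ‖φ l‖ ≤ 1) ∧
      ∀ y, ‖y‖ ≤ 2 * D * ∑ l, c l * ‖φ l y‖ := by
  classical
  have : ProperSpace E := FiniteDimensional.proper_rclike 𝕜 E
  obtain ⟨t, hts, htf, hcov⟩ := (isCompact_sphere (0 : E) 1).finite_cover_balls
    (e := 1 / (2 * D)) (by positivity)
  have : Fintype t := htf.fintype
  obtain ⟨ι, _, c, φ, hc, hc1, hφ, hdom⟩ := h.pietsch (Fintype.card t)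
    (fun j => ((Fintype.equivFin t).symm j : E))
    (fun j => by simpa using hts ((Fintype.equivFin t).symm j).2)
  refine ⟨ι, inferInstance, c, φ, hc, hc1, hφ, ?_⟩
  have hunit : ∀ y : E, ‖y‖ = 1 → 1 ≤ 2 * D * ∑ l, c l * ‖φ l y‖ := by
    intro y hy
    have hy' := hcov (show y ∈ Metric.sphere (0 : E) 1 by simpa using hy)
    simp only [Set.mem_iUnion, Metric.mem_ball, exists_prop] at hy'
    obtain ⟨x, hx, hxy⟩ := hy'
    have h1 := hdom (Fintype.equivFin t ⟨x, hx⟩)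
    simp only [Equiv.symm_apply_apply] at h1
    have h2 : ∑ l, c l * ‖φ l x‖ ≤ ∑ l, c l * ‖φ l y‖ + 1 / (2 * D) := by
      calc ∑ l, c l * ‖φ l x‖ ≤ ∑ l, (c l * ‖φ l y‖ + c l * (1 / (2 * D))) := by
            refine Finset.sum_le_sum fun l _ => ?_
            rw [← mul_add]
            refine mul_le_mul_of_nonneg_left ?_ (hc l)
            have h3 : φ l x = φ l y + φ l (x - y) := by simp
            have h4 := (φ l).le_of_opNorm_le (hφ l) (x - y)
            rw [dist_eq_norm, norm_sub_rev] at hxy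
            calc ‖φ l x‖ ≤ ‖φ l y‖ + ‖φ l (x - y)‖ := by rw [h3]; exact norm_add_le _ _
              _ ≤ _ := by linarith
        _ = _ := by rw [Finset.sum_add_distrib, ← Finset.sum_mul, hc1, one_mul]
    have h5 : D * (1 / (2 * D)) = 1 / 2 := by field_simp
    have h6 := mul_le_mul_of_nonneg_left h2 hD.le
    rw [mul_add, h5] at h6
    linarith
  intro y
  by_cases hy : y = 0
  · simp [hy]
  have hy0 : 0 < ‖y‖ := norm_pos_iff.2 hy
  have h1 := hunit _ (norm_smul_inv_norm (𝕜 := 𝕜) hy)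
  have h2 : ∑ l, c l * ‖φ l (((‖y‖ : 𝕜))⁻¹ • y)‖ = ‖y‖⁻¹ * ∑ l, c l * ‖φ l y‖ := by
    rw [Finset.mul_sum]
    refine Finset.sum_congr rfl fun l _ => ?_
    rw [map_smul, norm_smul, norm_inv, RCLike.norm_ofReal, abs_of_pos hy0]
    ring
  rw [h2] at h1
  have h3 := mul_le_mul_of_nonneg_left h1 hy0.le
  have h4 : ‖y‖ * (2 * D * (‖y‖⁻¹ * ∑ l, c l * ‖φ l y‖)) = 2 * D * ∑ l, c l * ‖φ l y‖ := by
    field_simp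
  linarith

theorem DRWeighted.finrank_le {𝕜 : Type*} [RCLike 𝕜] {E : Type*} [NormedAddCommGroup E]
    [NormedSpace 𝕜 E] [FiniteDimensional 𝕜 E] {D : ℝ} (hD : 0 < D) (h : DRWeighted 𝕜 E D) :
    (Module.finrank 𝕜 E : ℝ) ≤ (2 * D) ^ 2 := by
  obtain ⟨ι, _, c, φ, hc, hc1, hφ, hdom⟩ := h.domination hD
  let A : E →ₗ[𝕜] EuclideanSpace 𝕜 ι :=
    { toFun := fun y => WithLp.toLp 2 fun l => ((Real.sqrt (c l) : ℝ) : 𝕜) * φ l y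
      map_add' := fun x y => by ext l; simp [mul_add]
      map_smul' := fun a x => by ext l; simp; ring }
  have hA : ∀ y, ‖A y‖ ^ 2 = ∑ l, c l * ‖φ l y‖ ^ 2 := by
    intro y
    rw [EuclideanSpace.norm_sq_eq]
    refine Finset.sum_congr rfl fun l _ => ?_
    simp only [A, LinearMap.coe_mk, AddHom.coe_mk, norm_mul, RCLike.norm_ofReal, mul_pow, sq_abs,
      Real.sq_sqrt (hc l)]
  have hK : ∀ y, ‖y‖ ^ 2 ≤ (2 * D) ^ 2 * ‖A y‖ ^ 2 := by
    intro y
    have h1 : (∑ l, c l * ‖φ l y‖) ^ 2 ≤ ‖A y‖ ^ 2 := by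
      have := Finset.sum_mul_sq_le_sq_mul_sq Finset.univ (fun l => Real.sqrt (c l))
        (fun l => Real.sqrt (c l) * ‖φ l y‖)
      simp only [mul_pow, Real.sq_sqrt (hc _), hc1, one_mul, ← mul_assoc,
        Real.mul_self_sqrt (hc _)] at this
      rwa [hA]
    calc ‖y‖ ^ 2 ≤ (2 * D * ∑ l, c l * ‖φ l y‖) ^ 2 :=
          pow_le_pow_left₀ (norm_nonneg _) (hdom y) 2
      _ = (2 * D) ^ 2 * (∑ l, c l * ‖φ l y‖) ^ 2 := by ring
      _ ≤ _ := by gcongr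
  have hinj : Function.Injective A := by
    rw [← LinearMap.ker_eq_bot, LinearMap.ker_eq_bot']
    intro y hy
    have := hK y
    rw [hy] at this
    simp only [norm_zero] at this
    have h0 : ‖y‖ ^ 2 ≤ 0 := by simpa using this
    exact norm_eq_zero.1 (pow_eq_zero_iff (two_ne_zero) |>.1 (le_antisymm h0 (by positivity)))
  rw [← LinearMap.finrank_range_of_inj hinj]
  let b := stdOrthonormalBasis 𝕜 (LinearMap.range A)
  have hb : ∀ i, ∃ e, A e = (b i : EuclideanSpace 𝕜 ι) := fun i => (b i).2
  choose e he using hb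
  have hon : Orthonormal 𝕜 (fun i => A (e i)) := by
    have := b.orthonormal.comp_linearIsometry (LinearMap.range A).subtypeₗᵢ
    convert this using 2
    simp [he]
  have hS : ∀ l, ∑ i, ‖φ l (e i)‖ ^ 2 ≤ (2 * D) ^ 2 := by
    intro l
    set S := ∑ i, ‖φ l (e i)‖ ^ 2 with hSdef
    have hS0 : 0 ≤ S := Finset.sum_nonneg fun _ _ => by positivity
    let y := ∑ i, (starRingEnd 𝕜 (φ l (e i))) • e i
    have h1 : φ l y = (S : 𝕜) := by
      simp only [y, map_sum, map_smul, smul_eq_mul, RCLike.conj_mul, S]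
      push_cast
      rfl
    have h2 : S ≤ ‖y‖ := by
      have := (φ l).le_of_opNorm_le (hφ l) y
      rw [h1, RCLike.norm_ofReal, abs_of_nonneg hS0] at this
      linarith
    have h3 : ‖A y‖ ^ 2 = S := by
      have h4 : A y = ∑ i, (starRingEnd 𝕜 (φ l (e i))) • A (e i) := by
        simp only [y, map_sum, map_smul]
      have h5 : ((‖A y‖ ^ 2 : ℝ) : 𝕜) = (S : 𝕜) := by
        push_cast
        rw [← inner_self_eq_norm_sq_to_K (𝕜 := 𝕜), h4, hon.inner_sum]
        simp only [S, RCLike.conj_conj, RCLike.mul_conj]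
        push_cast
        rfl
      exact_mod_cast h5
    have h6 := hK y
    rw [h3] at h6
    have h7 : S ^ 2 ≤ (2 * D) ^ 2 * S := (pow_le_pow_left₀ hS0 h2 2).trans h6
    rcases hS0.eq_or_lt with h0 | h0
    · rw [← h0]; positivity
    · rw [sq S] at h7
      exact le_of_mul_le_mul_right h7 h0
  have hcount : ((Module.finrank 𝕜 (LinearMap.range A) : ℕ) : ℝ) = ∑ i, ‖A (e i)‖ ^ 2 := by
    simp [hon.norm_eq_one]
  rw [hcount]
  simp only [hA]
  rw [Finset.sum_comm]
  calc ∑ l, ∑ i, c l * ‖φ l (e i)‖ ^ 2 ≤ ∑ l, c l * (2 * D) ^ 2 := by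
        refine Finset.sum_le_sum fun l _ => ?_
        rw [← Finset.mul_sum]
        exact mul_le_mul_of_nonneg_left (hS l) (hc l)
    _ = _ := by rw [← Finset.sum_mul, hc1, one_mul]

theorem DRWeighted.finiteDimensional {𝕜 : Type*} [RCLike 𝕜] {E : Type*} [NormedAddCommGroup E]
    [NormedSpace 𝕜 E] {D : ℝ} (hD : 0 < D) (h : DRWeighted 𝕜 E D) :
    FiniteDimensional 𝕜 E := by
  by_contra hfin
  have h1 : Cardinal.aleph0 ≤ Module.rank 𝕜 E := by
    by_contra hlt
    exact hfin (Module.rank_lt_aleph0_iff.1 (not_le.1 hlt))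
  obtain ⟨N, hN⟩ := exists_nat_gt ((2 * D) ^ 2)
  obtain ⟨s, hs, hli⟩ := le_rank_iff_exists_linearIndependent_finset.1
    (Cardinal.aleph0_le.1 h1 N)
  have hF : FiniteDimensional 𝕜 (Submodule.span 𝕜 (s : Set E)) :=
    FiniteDimensional.span_finset 𝕜 s
  have h2 := (h.submodule (Submodule.span 𝕜 (s : Set E))).finrank_le hD
  have h3 : Module.finrank 𝕜 (Submodule.span 𝕜 (s : Set E)) = s.card :=
    finrank_span_finset_eq_card hli
  rw [h3, hs] at h2
  linarith

/-- The hard direction: from summability of one operator to the weighted inequality. -/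
theorem drWeighted_of_factStronglySumming {𝕜 : Type*} [RCLike 𝕜] {Y : Type*}
    [NormedAddCommGroup Y] [NormedSpace 𝕜 Y] (n : ℕ) (p : ℝ) (hp : 1 ≤ p)
    (hT : ∀ T : ContinuousMultilinearMap 𝕜 (fun _ : Fin (n + 1) => Y) Y,
      FactStronglySumming 𝕜 p T) (e : Y) (he : ‖e‖ = 1) :
    ∃ D : ℝ, 0 < D ∧ DRWeighted 𝕜 Y D := by
  have hp0 : 0 < p := by linarith
  obtain ⟨f, -, hfe⟩ := exists_dual_vector 𝕜 e (by rw [he]; exact one_ne_zero)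
  rw [he] at hfe
  let g : ContinuousMultilinearMap 𝕜 (fun _ : Fin n => Y) 𝕜 :=
    (ContinuousMultilinearMap.mkPiAlgebra 𝕜 (Fin n) 𝕜).compContinuousLinearMap (fun _ => f)
  let T : ContinuousMultilinearMap 𝕜 (fun _ : Fin (n + 1) => Y) Y :=
    ContinuousLinearMap.uncurryLeft (Ei := fun _ : Fin (n + 1) => Y)
      (ContinuousMultilinearMap.smulRightL 𝕜 (fun _ : Fin n => Y) Y g)
  have hTe : ∀ y : Y, T (Fin.cons y fun _ => e) = y := by
    intro y
    simp [T, g, hfe, ContinuousLinearMap.uncurryLeft_apply]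
  obtain ⟨C, hC, hbound⟩ := hT T
  refine ⟨C ^ p + 1, by positivity, ?_⟩
  intro m y w hy hw hW
  by_contra hcon
  push Not at hcon
  set W := ∑ j, w j with hWdef
  set D := C ^ p + 1 with hDdef
  have hD : 0 < D := by positivity
  have hb := hbound m 1 (fun j _ => Fin.cons (y j) fun _ => e)
    (fun j _ => (((w j) ^ (1 / p) : ℝ) : 𝕜))
  have hpow : ∀ j, ((w j) ^ (1 / p)) ^ p = w j := fun j => by
    rw [← Real.rpow_mul (hw j), one_div_mul_cancel hp0.ne', Real.rpow_one]
  have hterm : ∀ j (r : ℝ), 0 ≤ r → ((w j) ^ (1 / p) * r) ^ p = w j * r ^ p := fun j r hr => by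
    rw [Real.mul_rpow (Real.rpow_nonneg (hw j) _) hr, hpow]
  have habs : ∀ j, |(w j) ^ (1 / p)| = (w j) ^ (1 / p) :=
    fun j => abs_of_nonneg (Real.rpow_nonneg (hw j) _)
  simp only [Finset.univ_unique, Finset.sum_singleton, hTe, norm_smul, RCLike.norm_ofReal, habs,
    hy, mul_one, hpow, hterm _ _ (norm_nonneg _)] at hb
  have hsup : (⨆ φ : {φ : ContinuousMultilinearMap 𝕜 (fun _ : Fin (n + 1) => Y) 𝕜 // ‖φ‖ ≤ 1},
      (∑ j, w j * ‖φ.1 (Fin.cons (y j) fun _ => e)‖ ^ p) ^ (1 / p)) ≤ (W / D) ^ (1 / p) := by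
    have : Nonempty {φ : ContinuousMultilinearMap 𝕜 (fun _ : Fin (n + 1) => Y) 𝕜 // ‖φ‖ ≤ 1} :=
      ⟨⟨0, by simp⟩⟩
    refine ciSup_le fun φ => ?_
    refine Real.rpow_le_rpow (Finset.sum_nonneg fun j _ => mul_nonneg (hw j) (by positivity)) ?_
      (by positivity)
    let ψ : Y →L[𝕜] 𝕜 := φ.1.toContinuousLinearMap (fun _ => e) 0
    have hψ : ∀ x, ψ x = φ.1 (Fin.cons x fun _ => e) := by
      intro x
      change φ.1 (Function.update (fun _ => e) 0 x) = _
      congr 1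
      ext i
      refine Fin.cases ?_ (fun i => ?_) i <;> simp
    have hψb : ∀ x, ‖ψ x‖ ≤ 1 * ‖x‖ := by
      intro x
      rw [hψ]
      refine (φ.1.le_of_opNorm_le φ.2 _).trans ?_
      simp [Fin.prod_univ_succ, he]
    have h1 := hcon ψ (ContinuousLinearMap.opNorm_le_bound _ zero_le_one hψb)
    rw [le_div_iff₀ hD, mul_comm]
    refine le_trans ?_ h1
    refine mul_le_mul_of_nonneg_left (Finset.sum_le_sum fun j _ => ?_) hD.le
    refine mul_le_mul_of_nonneg_left ?_ (hw j)
    rw [← hψ]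
    have h2 := hψb (y j)
    rw [hy, mul_one] at h2
    calc ‖ψ (y j)‖ ^ p ≤ ‖ψ (y j)‖ ^ (1 : ℝ) :=
          Real.rpow_le_rpow_of_exponent_ge' (norm_nonneg _) h2 zero_le_one hp
      _ = _ := Real.rpow_one _
  have h1 := hb.trans (mul_le_mul_of_nonneg_left hsup hC)
  have h2 := Real.rpow_le_rpow (by positivity) h1 hp0.le
  have hWD : 0 ≤ W / D := by positivity
  rw [Real.mul_rpow hC (by positivity), ← Real.rpow_mul hW.le, ← Real.rpow_mul hWD,
    one_div_mul_cancel hp0.ne', Real.rpow_one, Real.rpow_one, ← mul_div_assoc,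
    le_div_iff₀ hD, hDdef] at h2
  linarith

/-- The easy direction. -/
theorem factStronglySumming_of_finiteDimensional {𝕜 : Type*} [RCLike 𝕜] {Y : Type*}
    [NormedAddCommGroup Y] [NormedSpace 𝕜 Y] [FiniteDimensional 𝕜 Y] (n : ℕ) (p : ℝ)
    (hp : 1 ≤ p) (T : ContinuousMultilinearMap 𝕜 (fun _ : Fin n => Y) Y) :
    FactStronglySumming 𝕜 p T := by
  have hp0 : 0 < p := by linarith
  let b := Module.finBasis 𝕜 Y
  let d := Module.finrank 𝕜 Y
  let cf : Fin d → Y →L[𝕜] 𝕜 := fun k => LinearMap.toContinuousLinearMap (b.coord k)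
  let Φ : Fin d → ContinuousMultilinearMap 𝕜 (fun _ : Fin n => Y) 𝕜 :=
    fun k => (cf k).compContinuousMultilinearMap T
  let K : ℝ := (d : ℝ) ^ (p - 1) * ∑ k, (‖b k‖ * (‖Φ k‖ + 1)) ^ p
  have hK : 0 ≤ K := by positivity
  refine ⟨K ^ (1 / p), by positivity, ?_⟩
  intro m₁ m₂ x lam
  set q : ContinuousMultilinearMap 𝕜 (fun _ : Fin n => Y) 𝕜 → ℝ :=
    fun φ => ∑ j, ‖∑ i, lam j i • φ (x j i)‖ ^ p with hq
  have hq0 : ∀ φ, 0 ≤ q φ := fun φ => Finset.sum_nonneg fun _ _ => by positivity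
  set S : ℝ := ⨆ φ : {φ : ContinuousMultilinearMap 𝕜 (fun _ : Fin n => Y) 𝕜 // ‖φ‖ ≤ 1},
    (q φ.1) ^ (1 / p) with hS
  have hbdd : BddAbove (Set.range fun φ : {φ : ContinuousMultilinearMap 𝕜 (fun _ : Fin n => Y) 𝕜 //
      ‖φ‖ ≤ 1} => (q φ.1) ^ (1 / p)) := by
    refine ⟨(∑ j, (∑ i, ‖lam j i‖ * ∏ k, ‖x j i k‖) ^ p) ^ (1 / p), ?_⟩
    rintro _ ⟨φ, rfl⟩
    refine Real.rpow_le_rpow (hq0 _) (Finset.sum_le_sum fun j _ => ?_) (by positivity)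
    refine Real.rpow_le_rpow (norm_nonneg _) ?_ hp0.le
    refine (norm_sum_le _ _).trans (Finset.sum_le_sum fun i _ => ?_)
    rw [norm_smul]
    refine mul_le_mul_of_nonneg_left ?_ (norm_nonneg _)
    simpa using φ.1.le_of_opNorm_le φ.2 (x j i)
  have hS0 : 0 ≤ S := Real.iSup_nonneg fun φ => Real.rpow_nonneg (hq0 _) _
  have hqS1 : ∀ φ : ContinuousMultilinearMap 𝕜 (fun _ : Fin n => Y) 𝕜, ‖φ‖ ≤ 1 → q φ ≤ S ^ p := by
    intro φ hφ
    have h1 : (q φ) ^ (1 / p) ≤ S := le_ciSup hbdd ⟨φ, hφ⟩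
    have h2 := Real.rpow_le_rpow (Real.rpow_nonneg (hq0 _) _) h1 hp0.le
    rwa [← Real.rpow_mul (hq0 _), one_div_mul_cancel hp0.ne', Real.rpow_one] at h2
  have hqS : ∀ φ : ContinuousMultilinearMap 𝕜 (fun _ : Fin n => Y) 𝕜,
      q φ ≤ (‖φ‖ + 1) ^ p * S ^ p := by
    intro φ
    have hpos : 0 < ‖φ‖ + 1 := by positivity
    let a : 𝕜 := ((‖φ‖ + 1 : ℝ) : 𝕜)
    have ha : ‖a‖ = ‖φ‖ + 1 := by
      rw [RCLike.norm_ofReal, abs_of_pos hpos]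
    have ha0 : a ≠ 0 := norm_pos_iff.1 (ha ▸ hpos)
    have h1 := hqS1 (a⁻¹ • φ) (by
      rw [norm_smul, norm_inv, ha, inv_mul_le_iff₀ hpos]
      linarith)
    have h2 : q φ = (‖φ‖ + 1) ^ p * q (a⁻¹ • φ) := by
      simp only [hq]
      rw [Finset.mul_sum]
      refine Finset.sum_congr rfl fun j _ => ?_
      rw [← Real.mul_rpow hpos.le (norm_nonneg _), ← ha, ← norm_smul, Finset.smul_sum]
      congr 3
      funext i
      simp only [smul_apply, smul_eq_mul]
      field_simp
    rw [h2]
    exact mul_le_mul_of_nonneg_left h1 (by positivity)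
  have hmain : ∑ j, ‖∑ i, lam j i • T (x j i)‖ ^ p ≤ K * S ^ p := by
    calc ∑ j, ‖∑ i, lam j i • T (x j i)‖ ^ p
        ≤ ∑ j, (d : ℝ) ^ (p - 1) * ∑ k, (‖b k‖ * ‖∑ i, lam j i • Φ k (x j i)‖) ^ p := by
          refine Finset.sum_le_sum fun j _ => ?_
          set z := ∑ i, lam j i • T (x j i) with hz
          have hzk : ∀ k, ∑ i, lam j i • Φ k (x j i) = b.repr z k := by
            intro k
            change ∑ i, lam j i • b.coord k (T (x j i)) = b.coord k z
            rw [hz, map_sum]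
            simp only [map_smul]
          have h1 : ‖z‖ ≤ ∑ k, |‖b k‖ * ‖b.repr z k‖| := by
            conv_lhs => rw [← b.sum_repr z]
            refine (norm_sum_le _ _).trans (Finset.sum_le_sum fun k _ => ?_)
            rw [norm_smul, mul_comm]
            exact le_abs_self _
          have h2 := Real.rpow_sum_le_const_mul_sum_rpow Finset.univ
            (fun k => ‖b k‖ * ‖b.repr z k‖) hp
          refine (Real.rpow_le_rpow (norm_nonneg _) h1 hp0.le).trans (h2.trans (le_of_eq ?_))
          simp only [hzk, Finset.card_univ, Fintype.card_fin, abs_mul, abs_norm]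
          rfl
      _ = (d : ℝ) ^ (p - 1) * ∑ k, ‖b k‖ ^ p * q (Φ k) := by
          rw [← Finset.mul_sum, Finset.sum_comm]
          congr 1
          refine Finset.sum_congr rfl fun k _ => ?_
          simp only [hq]
          rw [Finset.mul_sum]
          refine Finset.sum_congr rfl fun j _ => ?_
          rw [Real.mul_rpow (norm_nonneg _) (norm_nonneg _)]
      _ ≤ (d : ℝ) ^ (p - 1) * ∑ k, ‖b k‖ ^ p * ((‖Φ k‖ + 1) ^ p * S ^ p) := by
          gcongr
          exact hqS _
      _ = K * S ^ p := by
          simp only [K]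
          rw [mul_assoc, Finset.sum_mul]
          congr 1
          refine Finset.sum_congr rfl fun k _ => ?_
          rw [Real.mul_rpow (norm_nonneg _) (by positivity), mul_assoc]
  have h := Real.rpow_le_rpow (Finset.sum_nonneg fun _ _ => by positivity) hmain
    (show 0 ≤ 1 / p by positivity)
  rwa [Real.mul_rpow hK (by positivity), ← Real.rpow_mul hS0, mul_one_div_cancel hp0.ne',
    Real.rpow_one] at h

/-- Dvoretzky–Rogers type theorem: every continuous `n`-linear operator
`T : Y × ⋯ × Y → Y` is factorable strongly `p`-summing iff `Y` is finite-dimensional. -/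
theorem dvoretzkyRogers_factStronglySumming
    {𝕜 : Type*} [RCLike 𝕜] (Y : Type*)
    [NormedAddCommGroup Y] [NormedSpace 𝕜 Y] [CompleteSpace Y]
    (n : ℕ) (hn : 0 < n) (p : ℝ) (hp : 1 ≤ p) :
    (∀ T : ContinuousMultilinearMap 𝕜 (fun _ : Fin n => Y) Y, FactStronglySumming 𝕜 p T) ↔
      FiniteDimensional 𝕜 Y := by
  constructor
  · intro h
    obtain ⟨n, rfl⟩ : ∃ k, n = k + 1 := ⟨n - 1, by omega⟩
    rcases subsingleton_or_nontrivial Y with hs | hs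
    · infer_instance
    obtain ⟨x, hx⟩ := exists_ne (0 : Y)
    obtain ⟨D, hD, hW⟩ := drWeighted_of_factStronglySumming n p hp h _
      (norm_smul_inv_norm (𝕜 := 𝕜) hx)
    exact hW.finiteDimensional hD
  · intro h T
    exact factStronglySumming_of_finiteDimensional n p hp T
end

section
/- (Dvoretzky–Rogers type theorem for polynomials) Let Y be a Banach space, n a positive integer and 1 ≤ p < ∞. Every continuous n-homogeneous polynomial P : Y → Y is factorable strongly p-summing if and only if Y is finite-dimensional. -/
open scoped BigOperators
open MeasureTheory

/-- An infinite-dimensional space contains injective linear images of Euclidean spaces. -/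
theorem dr_injective {𝕜 Z : Type*} [RCLike 𝕜] [NormedAddCommGroup Z] [NormedSpace 𝕜 Z]
    (h : ¬ FiniteDimensional 𝕜 Z) (N : ℕ) :
    ∃ f : EuclideanSpace 𝕜 (Fin N) →ₗ[𝕜] Z, Function.Injective f := by
  have b := Module.Basis.ofVectorSpace 𝕜 Z
  have hinf : Infinite (Module.Basis.ofVectorSpaceIndex 𝕜 Z) := by
    by_contra hf
    rw [not_infinite_iff_finite] at hf
    exact h (Module.Finite.of_basis b)
  let e := Infinite.natEmbedding (Module.Basis.ofVectorSpaceIndex 𝕜 Z)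
  have hli : LinearIndependent 𝕜 (fun i : Fin N => b (e i)) :=
    b.linearIndependent.comp (fun i : Fin N => e i)
      (fun i j hij => Fin.ext (e.injective hij))
  refine ⟨(Fintype.linearCombination 𝕜 (fun i : Fin N => b (e i))) ∘ₗ
    (WithLp.linearEquiv 2 𝕜 (Fin N → 𝕜)).toLinearMap, ?_⟩
  have h1 : Function.Injective (Fintype.linearCombination 𝕜 (fun i : Fin N => b (e i))) :=
    hli.fintypeLinearCombination_injective
  exact h1.comp (WithLp.linearEquiv 2 𝕜 (Fin N → 𝕜)).injective

/-- Diagonal operator in an orthonormal basis. -/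
theorem dr_diag {𝕜 H : Type*} [RCLike 𝕜] [NormedAddCommGroup H] [InnerProductSpace 𝕜 H]
    [FiniteDimensional 𝕜 H] {N : ℕ} (e : OrthonormalBasis (Fin N) 𝕜 H) (c : Fin N → 𝕜) :
    ∃ w : H →L[𝕜] H, (∀ x, w x = ∑ j, (c j * inner 𝕜 (e j) x) • e j) ∧ w.det = ∏ j, c j := by
  let w : H →ₗ[𝕜] H := e.toBasis.constr 𝕜 (fun j => c j • e j)
  refine ⟨LinearMap.toContinuousLinearMap w, ?_, ?_⟩
  · intro x
    simp only [LinearMap.coe_toContinuousLinearMap', w, Module.Basis.constr_apply_fintype]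
    refine Finset.sum_congr rfl fun j _ => ?_
    rw [smul_smul, mul_comm]
    congr 2
    simp [OrthonormalBasis.repr_apply_apply]
  · have : (LinearMap.toContinuousLinearMap w).det = LinearMap.det w := by
      simp [ContinuousLinearMap.det]
    rw [this, ← LinearMap.det_toMatrix e.toBasis, ← Matrix.det_diagonal]
    congr 1
    ext i j
    rw [LinearMap.toMatrix_apply]
    simp only [w, Module.Basis.constr_basis]
    simp [Matrix.diagonal_apply]
    grind

/-- A maximal volume operator. -/
theorem dr_max {𝕜 H Z : Type*} [RCLike 𝕜] [NormedAddCommGroup H] [InnerProductSpace 𝕜 H]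
    [FiniteDimensional 𝕜 H] [NormedAddCommGroup Z] [NormedSpace 𝕜 Z]
    (f : H →L[𝕜] Z) (hf : Function.Injective f) :
    ∃ g : H →L[𝕜] H, ‖f.comp g‖ ≤ 1 ∧ g.det ≠ 0 ∧
      ∀ g' : H →L[𝕜] H, ‖f.comp g'‖ ≤ 1 → ‖g'.det‖ ≤ ‖g.det‖ := by
  obtain ⟨K, hK, hanti⟩ := LinearMap.exists_antilipschitzWith (f : H →ₗ[𝕜] Z)
    (LinearMap.ker_eq_bot.2 hf)
  let S : Set (H →L[𝕜] H) := {g | ‖f.comp g‖ ≤ 1}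
  have hcl : IsClosed S := by
    apply isClosed_le _ continuous_const
    exact (continuous_const.clm_comp continuous_id).norm
  have hS : S ⊆ Metric.closedBall 0 K := by
    intro g hg
    rw [mem_closedBall_zero_iff]
    refine ContinuousLinearMap.opNorm_le_bound _ K.2 fun x => ?_
    have h1 := hanti.le_mul_dist (g x) 0
    have h2 : ‖f (g x)‖ ≤ 1 * ‖x‖ := (f.comp g).le_of_opNorm_le hg x
    simp only [dist_zero_right, map_zero] at h1
    refine h1.trans ?_
    simp only [one_mul] at h2
    exact mul_le_mul_of_nonneg_left h2 K.2
  have : ProperSpace (H →L[𝕜] H) := FiniteDimensional.proper 𝕜 _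
  have hcomp : IsCompact S := (isCompact_closedBall (0 : H →L[𝕜] H) (K : ℝ)).of_isClosed_subset hcl hS
  obtain ⟨g, hgS, hg⟩ := hcomp.exists_isMaxOn ⟨0, by simp [S]⟩
    (ContinuousLinearMap.continuous_det (𝕜 := 𝕜) (E := H)).norm.continuousOn
  refine ⟨g, hgS, ?_, fun g' hg' => hg hg'⟩
  let r : ℝ := (‖f‖ + 1)⁻¹
  have hr : 0 < r := by positivity
  have h0 : ((r : 𝕜) • ContinuousLinearMap.id 𝕜 H) ∈ S := by
    simp only [S, Set.mem_ofPred_eq]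
    refine ContinuousLinearMap.opNorm_le_bound _ zero_le_one fun x => ?_
    simp only [ContinuousLinearMap.comp_apply, smul_apply, map_smul, norm_smul,
      ContinuousLinearMap.id_apply, RCLike.norm_ofReal, abs_of_pos hr]
    have := f.le_opNorm x
    calc r * ‖f x‖ ≤ r * (‖f‖ * ‖x‖) := by gcongr
      _ ≤ r * ((‖f‖ + 1) * ‖x‖) := by gcongr; linarith
      _ = 1 * ‖x‖ := by simp only [r]; field_simp
  have h1 := hg h0
  intro h2
  simp only [Set.mem_ofPred_eq, h2, norm_zero] at h1
  have h3 : ((r : 𝕜) • ContinuousLinearMap.id 𝕜 H).det = (r : 𝕜) ^ Module.finrank 𝕜 H := by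
    simp [ContinuousLinearMap.det]
  rw [h3, norm_pow, RCLike.norm_ofReal, abs_of_pos hr] at h1
  exact absurd h1 (not_le.2 (pow_pos hr _))

/-- An orthonormal basis with a maximal number of vectors not contracted by `u`. -/
theorem dr_basis {𝕜 H Z : Type*} [RCLike 𝕜] [NormedAddCommGroup H] [InnerProductSpace 𝕜 H]
    [FiniteDimensional 𝕜 H] [NormedAddCommGroup Z] [NormedSpace 𝕜 Z]
    {N : ℕ} (e0 : OrthonormalBasis (Fin N) 𝕜 H) (u : H →L[𝕜] Z) :
    ∃ (e : OrthonormalBasis (Fin N) 𝕜 H) (A : Finset (Fin N)), (∀ j ∈ A, 1 / 2 ≤ ‖u (e j)‖) ∧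
      ∀ x, (∀ j ∈ A, inner 𝕜 (e j) x = 0) → ‖u x‖ ≤ 1 / 2 * ‖x‖ := by
  classical
  let Q : ℕ → Prop := fun k => ∃ (e : OrthonormalBasis (Fin N) 𝕜 H) (A : Finset (Fin N)),
    (∀ j ∈ A, 1 / 2 ≤ ‖u (e j)‖) ∧ A.card = k
  have hQ0 : Q 0 := ⟨e0, ∅, by simp, rfl⟩
  have hQN : ∀ k, Q k → k ≤ N := by
    rintro k ⟨e, A, -, rfl⟩
    simpa using A.card_le_univ
  obtain ⟨e, A, hA, hAk⟩ := Nat.findGreatest_spec (P := Q) (Nat.zero_le N) hQ0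
  refine ⟨e, A, hA, fun x hx => ?_⟩
  by_contra hcon
  push Not at hcon
  have hx0 : x ≠ 0 := by rintro rfl; simp at hcon
  have hxn : 0 < ‖x‖ := norm_pos_iff.2 hx0
  obtain ⟨j0, hj0⟩ : ∃ j0, j0 ∉ A := by
    by_contra hall
    push Not at hall
    apply hx0
    rw [← e.sum_repr' x]
    exact Finset.sum_eq_zero fun j _ => by rw [hx j (hall j), zero_smul]
  let y : H := ((‖x‖⁻¹ : ℝ) : 𝕜) • x
  have hy1 : ‖y‖ = 1 := by
    simp only [y, norm_smul, RCLike.norm_ofReal, abs_inv, abs_norm]; field_simp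
  have hyA : ∀ j ∈ A, inner 𝕜 (e j) y = 0 := fun j hj => by
    simp only [y, inner_smul_right, hx j hj, mul_zero]
  have hyu : 1 / 2 ≤ ‖u y‖ := by
    simp only [y, map_smul, norm_smul, RCLike.norm_ofReal, abs_inv, abs_norm]
    rw [inv_mul_eq_div, le_div_iff₀ hxn]; exact hcon.le
  have hcard : Module.finrank 𝕜 H = Fintype.card (Fin N) :=
    Module.finrank_eq_card_basis e.toBasis
  let v : Fin N → H := Function.update e j0 y
  have hv0 : v j0 = y := by simp [v]
  have hvA : ∀ j ∈ A, v j = e j := fun j hj => by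
    have : j ≠ j0 := fun h => hj0 (h ▸ hj)
    simp [v, this]
  have hort : Orthonormal 𝕜
      (((insert j0 A : Finset (Fin N)) : Set (Fin N)).domRestrict v) := by
    constructor
    · rintro ⟨j, hj⟩
      change ‖v j‖ = 1
      rcases Finset.mem_insert.1 (Finset.mem_coe.1 hj) with rfl | hj
      · rw [hv0, hy1]
      · rw [hvA j hj]; exact e.norm_eq_one j
    · rintro ⟨i, hi⟩ ⟨j, hj⟩ hij
      have hij' : i ≠ j := fun h => hij (Subtype.ext h)
      change inner 𝕜 (v i) (v j) = 0
      rcases Finset.mem_insert.1 (Finset.mem_coe.1 hi) with rfl | hi' <;>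
      rcases Finset.mem_insert.1 (Finset.mem_coe.1 hj) with rfl | hj'
      · exact absurd rfl hij'
      · rw [hv0, hvA j hj']; exact inner_eq_zero_symm.1 (hyA j hj')
      · rw [hv0, hvA i hi']; exact hyA i hi'
      · rw [hvA i hi', hvA j hj']; exact e.inner_eq_zero hij'
  obtain ⟨b, hb⟩ := hort.exists_orthonormalBasis_extension_of_card_eq hcard
  have hQ : Q (A.card + 1) := by
    refine ⟨b, insert j0 A, ?_, Finset.card_insert_of_notMem hj0⟩
    intro j hj
    rw [hb j (by exact_mod_cast hj)]
    rcases Finset.mem_insert.1 hj with rfl | hj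
    · rwa [hv0]
    · rw [hvA j hj]; exact hA j hj
  have := Nat.le_findGreatest (P := Q) (hQN _ hQ) hQ
  omega

set_option maxHeartbeats 2000000 in
/-- Dvoretzky–Rogers lemma (weak form). -/
theorem dr_lemma {𝕜 Z : Type*} [RCLike 𝕜] [NormedAddCommGroup Z] [NormedSpace 𝕜 Z]
    (h : ¬ FiniteDimensional 𝕜 Z) (N : ℕ) :
    ∃ (z : Fin N → Z) (A : Finset (Fin N)), N ≤ 2 * A.card ∧ (∀ j ∈ A, 1 / 2 ≤ ‖z j‖) ∧
      ∀ f : Z →L[𝕜] 𝕜, ∑ j, ‖f (z j)‖ ^ 2 ≤ ‖f‖ ^ 2 := by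
  classical
  obtain ⟨f0, hf0⟩ := dr_injective (𝕜 := 𝕜) h N
  let f := LinearMap.toContinuousLinearMap f0
  have hf : Function.Injective f := hf0
  obtain ⟨g, hg1, hgdet, hgmax⟩ := dr_max f hf
  obtain ⟨e, A, hA, hAx⟩ := dr_basis (EuclideanSpace.basisFun (Fin N) 𝕜) (f.comp g)
  set u := f.comp g with hu
  refine ⟨fun j => u (e j), A, ?_, hA, ?_⟩
  · by_contra hN
    push Not at hN
    let s : ℝ := √2
    have hs : s * s = 2 := Real.mul_self_sqrt (by norm_num)
    have hs1 : 1 < s := by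
      have : 0 ≤ s := Real.sqrt_nonneg 2
      nlinarith
    let c : Fin N → 𝕜 := fun j => if j ∈ A then ((s⁻¹ : ℝ) : 𝕜) else ((s : ℝ) : 𝕜)
    obtain ⟨w, hw, hwdet⟩ := dr_diag e c
    have hbound : ‖f.comp (g.comp w)‖ ≤ 1 := by
      refine ContinuousLinearMap.opNorm_le_bound _ zero_le_one fun x => ?_
      let x1 := ∑ j ∈ A, inner 𝕜 (e j) x • e j
      let x2 := ∑ j ∈ Aᶜ, inner 𝕜 (e j) x • e j
      have hx : x = x1 + x2 := by
        rw [Finset.sum_add_sum_compl, e.sum_repr']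
      have hwx : w x = ((s⁻¹ : ℝ) : 𝕜) • x1 + ((s : ℝ) : 𝕜) • x2 := by
        rw [hw, ← Finset.sum_add_sum_compl A, Finset.smul_sum, Finset.smul_sum]
        congr 1
        · refine Finset.sum_congr rfl fun j hj => ?_
          simp only [c, if_pos hj, smul_smul]
        · refine Finset.sum_congr rfl fun j hj => ?_
          simp only [c, if_neg (Finset.mem_compl.1 hj), smul_smul]
      have hAx2 : ∀ j ∈ A, inner 𝕜 (e j) x2 = 0 := by
        intro j hj
        simp only [x2, inner_sum, inner_smul_right]
        refine Finset.sum_eq_zero fun i hi => ?_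
        have : j ≠ i := fun h => (Finset.mem_compl.1 hi) (h ▸ hj)
        rw [e.inner_eq_zero this, mul_zero]
      have h12 : inner 𝕜 x1 x2 = 0 := by
        simp only [x1, sum_inner, inner_smul_left]
        exact Finset.sum_eq_zero fun j hj => by rw [hAx2 j hj, mul_zero]
      have hpyth := norm_add_sq_eq_norm_sq_add_norm_sq_of_inner_eq_zero x1 x2 h12
      rw [← hx] at hpyth
      have h2 := hAx x2 hAx2
      have h1 : ‖u x1‖ ≤ 1 * ‖x1‖ := u.le_of_opNorm_le hg1 x1
      have h3 : ‖u (w x)‖ ≤ s⁻¹ * ‖u x1‖ + s * ‖u x2‖ := by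
        rw [hwx, map_add, map_smul, map_smul]
        refine (norm_add_le _ _).trans ?_
        rw [norm_smul, norm_smul, RCLike.norm_ofReal, RCLike.norm_ofReal,
          abs_of_pos (by positivity : (0:ℝ) < s⁻¹), abs_of_pos (by positivity : (0:ℝ) < s)]
      have hs0 : 0 < s := by positivity
      have hsi : s⁻¹ = s / 2 := by field_simp; nlinarith
      have h4 : ‖u (w x)‖ ≤ s / 2 * (‖x1‖ + ‖x2‖) := by
        rw [hsi] at h3
        have h5 : s / 2 * ‖u x1‖ ≤ s / 2 * ‖x1‖ := by
          apply mul_le_mul_of_nonneg_left _ (by positivity); linarith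
        have h6 : s * ‖u x2‖ ≤ s * (1 / 2 * ‖x2‖) := mul_le_mul_of_nonneg_left h2 hs0.le
        linarith
      change ‖u (w x)‖ ≤ 1 * ‖x‖
      rw [one_mul]
      refine h4.trans ?_
      refine le_trans (le_abs_self _) (abs_le_of_sq_le_sq ?_ (norm_nonneg x))
      have : (s / 2 * (‖x1‖ + ‖x2‖)) ^ 2 = (s * s) / 4 * (‖x1‖ + ‖x2‖) ^ 2 := by ring
      rw [this, hs]
      nlinarith [sq_nonneg (‖x1‖ - ‖x2‖)]
    have hm := hgmax _ hbound
    have hdet : (g.comp w).det = g.det * w.det := by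
      simp [ContinuousLinearMap.det, LinearMap.det_comp]
    rw [hdet, norm_mul, hwdet] at hm
    have hgpos : 0 < ‖g.det‖ := norm_pos_iff.2 hgdet
    have hprod : ‖∏ j, c j‖ ≤ 1 := by
      by_contra hc
      push Not at hc
      nlinarith
    have hprod2 : ‖∏ j, c j‖ = (s⁻¹) ^ A.card * s ^ (N - A.card) := by
      have hs0 : 0 < s := by positivity
      rw [norm_prod, ← Finset.prod_mul_prod_compl A]
      congr 1
      · rw [Finset.prod_congr rfl (g := fun _ => s⁻¹)]
        · simp
        · intro j hj
          simp only [c, if_pos hj, RCLike.norm_ofReal]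
          exact abs_of_pos (by positivity)
      · rw [Finset.prod_congr rfl (g := fun _ => s)]
        · simp [Finset.card_compl]
        · intro j hj
          simp only [c, if_neg (Finset.mem_compl.1 hj), RCLike.norm_ofReal]
          exact abs_of_pos hs0
    have hlt : A.card < N - A.card := by omega
    have h7 : s ^ A.card < s ^ (N - A.card) := pow_lt_pow_right₀ hs1 hlt
    rw [hprod2, inv_pow, inv_mul_le_iff₀ (by positivity)] at hprod
    linarith
  · intro φ
    let ψ := φ.comp u
    have hψ : ‖ψ‖ ≤ ‖φ‖ := by
      refine (ContinuousLinearMap.opNorm_comp_le _ _).trans ?_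
      nlinarith [norm_nonneg φ]
    let y := (InnerProductSpace.toDual 𝕜 (EuclideanSpace 𝕜 (Fin N))).symm ψ
    have hy : ‖y‖ = ‖ψ‖ := LinearIsometryEquiv.norm_map _ _
    have h1 := e.sum_sq_norm_inner_left y
    have h2 : ∀ j, inner 𝕜 y (e j) = φ (u (e j)) := fun j =>
      InnerProductSpace.toDual_symm_apply
    simp only [h2] at h1
    rw [h1, hy]
    exact pow_le_pow_left₀ (norm_nonneg _) hψ 2

theorem interp_coeffs (𝕜 : Type*) [RCLike 𝕜] (n : ℕ) :
    ∃ lam t : Fin (n + 1) → 𝕜, ∀ k ≤ n, ∑ i, lam i * t i ^ k = if k = 1 then 1 else 0 := by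
  classical
  let t : Fin (n + 1) → 𝕜 := fun i => ((i : ℕ) : 𝕜)
  have ht : Function.Injective t := fun i j h => Fin.ext (Nat.cast_injective h)
  refine ⟨fun i => (Lagrange.basis Finset.univ t i).coeff 1, t, fun k hk => ?_⟩
  have h := Lagrange.eq_interpolate (s := Finset.univ) (v := t) (f := (Polynomial.X ^ k : Polynomial 𝕜))
    ht.injOn (by
      rw [Polynomial.degree_X_pow]
      simp only [Finset.card_univ, Fintype.card_fin]
      exact_mod_cast Nat.lt_succ_of_le hk)
  have h1 := congrArg (fun q => Polynomial.coeff q 1) h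
  simp only [Lagrange.interpolate_apply, Polynomial.finsetSum_coeff, Polynomial.coeff_C_mul,
    Polynomial.eval_pow, Polynomial.eval_X, Polynomial.coeff_X_pow] at h1
  rw [Finset.sum_congr rfl fun i _ => mul_comm _ _, ← h1]
  simp [eq_comm]

/-- Bound of a homogeneous polynomial by its norm. -/
theorem poly_bddAbove {𝕜 X Y : Type*} [RCLike 𝕜] [NormedAddCommGroup X] [NormedSpace 𝕜 X]
    [NormedAddCommGroup Y] [NormedSpace 𝕜 Y] {n : ℕ} {q : X → Y} (hq : IsHomogPoly 𝕜 n q) :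
    BddAbove (Set.range fun x : {x : X // ‖x‖ ≤ 1} => ‖q x.1‖) := by
  obtain ⟨T, hT⟩ := hq
  refine ⟨‖T‖, ?_⟩
  rintro _ ⟨x, rfl⟩
  simp only [hT]
  refine (T.le_opNorm _).trans ?_
  have : ∏ _i : Fin n, ‖(x : X)‖ ≤ 1 := Finset.prod_le_one (fun _ _ => norm_nonneg _) fun _ _ => x.2
  nlinarith [norm_nonneg T]

theorem poly_smul {𝕜 X Y : Type*} [RCLike 𝕜] [NormedAddCommGroup X] [NormedSpace 𝕜 X]
    [NormedAddCommGroup Y] [NormedSpace 𝕜 Y] {n : ℕ} {q : X → Y} (hq : IsHomogPoly 𝕜 n q)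
    (c : 𝕜) (x : X) : q (c • x) = c ^ n • q x := by
  obtain ⟨T, hT⟩ := hq
  rw [hT, hT]
  have := T.map_smul_univ (fun _ => c) (fun _ => x)
  simpa using this

theorem poly_bound {𝕜 X Y : Type*} [RCLike 𝕜] [NormedAddCommGroup X] [NormedSpace 𝕜 X]
    [NormedAddCommGroup Y] [NormedSpace 𝕜 Y] {n : ℕ} {q : X → Y} (hq : IsHomogPoly 𝕜 n q) (x : X)
    {r : ℝ} (hr : 0 < r) (hx : ‖x‖ ≤ r) : ‖q x‖ ≤ polyNorm q * r ^ n := by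
  let y : X := ((r⁻¹ : ℝ) : 𝕜) • x
  have hy : ‖y‖ ≤ 1 := by
    simp only [y, norm_smul, RCLike.norm_ofReal, abs_inv, abs_of_pos hr]
    rw [inv_mul_eq_div, div_le_one hr]; exact hx
  have hxy : x = (r : 𝕜) • y := by
    simp only [y, smul_smul, ← RCLike.ofReal_mul, mul_inv_cancel₀ hr.ne', RCLike.ofReal_one, one_smul]
  have h1 : ‖q y‖ ≤ polyNorm q := le_ciSup (poly_bddAbove hq) (⟨y, hy⟩ : {x : X // ‖x‖ ≤ 1})
  rw [hxy, poly_smul hq, norm_smul, norm_pow, RCLike.norm_ofReal, abs_of_pos hr, mul_comm]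
  gcongr

theorem poly_sup_bdd {𝕜 X : Type*} [RCLike 𝕜] [NormedAddCommGroup X] [NormedSpace 𝕜 X]
    {n : ℕ} {p : ℝ} (hp : 1 ≤ p) {m₁ m₂ : ℕ} (x : Fin m₁ → Fin m₂ → X) (lam : Fin m₁ → Fin m₂ → 𝕜) :
    BddAbove (Set.range fun q : {q : X → 𝕜 // IsHomogPoly 𝕜 n q ∧ polyNorm q ≤ 1} =>
        (∑ j, ‖∑ i, lam j i • q.1 (x j i)‖ ^ p) ^ (1 / p)) := by
  refine ⟨(∑ j, (∑ i, ‖lam j i‖ * (‖x j i‖ + 1) ^ n) ^ p) ^ (1 / p), ?_⟩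
  rintro _ ⟨⟨q, hq, hq1⟩, rfl⟩
  have hp0 : 0 ≤ p := by linarith
  simp only
  gcongr with j _
  refine (norm_sum_le _ _).trans (Finset.sum_le_sum fun i _ => ?_)
  rw [norm_smul]
  gcongr
  have := poly_bound hq (x j i) (r := ‖x j i‖ + 1) (by positivity) (by linarith)
  have h2 : 0 ≤ (‖x j i‖ + 1) ^ n := by positivity
  nlinarith

theorem minkowski_sum {ι κ : Type*} (s : Finset κ) (t : Finset ι) {p : ℝ} (hp : 1 ≤ p)
    (f : κ → ι → ℝ) (hf : ∀ k j, 0 ≤ f k j) :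
    (∑ j ∈ t, (∑ k ∈ s, f k j) ^ p) ^ (1 / p) ≤ ∑ k ∈ s, (∑ j ∈ t, f k j ^ p) ^ (1 / p) := by
  classical
  have hp0 : p ≠ 0 := by linarith
  induction s using Finset.induction_on with
  | empty => simp [Real.zero_rpow hp0, Real.zero_rpow (inv_ne_zero hp0)]
  | insert a s ha ih =>
    simp only [Finset.sum_insert ha]
    refine (Real.Lp_add_le_of_nonneg t hp (fun j _ => hf a j)
      (fun j _ => Finset.sum_nonneg fun k _ => hf k j)).trans ?_
    gcongr

theorem finite_dim_direction {𝕜 : Type*} [RCLike 𝕜] (Y : Type*)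
    [NormedAddCommGroup Y] [NormedSpace 𝕜 Y] [FiniteDimensional 𝕜 Y]
    (n : ℕ) (p : ℝ) (hp : 1 ≤ p) (P : Y → Y) (hP : IsHomogPoly 𝕜 n P) :
    FactStronglySummingPoly 𝕜 n p P := by
  classical
  refine ⟨hP, ?_⟩
  let b := Module.finBasis 𝕜 Y
  obtain ⟨T, hT⟩ := hP
  let co : Fin (Module.finrank 𝕜 Y) → (Y →L[𝕜] 𝕜) := fun k => LinearMap.toContinuousLinearMap (b.coord k)
  let q : Fin (Module.finrank 𝕜 Y) → Y → 𝕜 := fun k y => co k (P y)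
  have hq : ∀ k, IsHomogPoly 𝕜 n (q k) := fun k =>
    ⟨(co k).compContinuousMultilinearMap T, fun y => by simp [q, hT]⟩
  have hPq : ∀ y, P y = ∑ k, q k y • b k := fun y => (b.sum_repr (P y)).symm
  have hpn : ∀ k, 0 ≤ polyNorm (q k) := fun k => Real.iSup_nonneg fun _ => norm_nonneg _
  refine ⟨∑ k, ‖b k‖ * (polyNorm (q k) + 1), by
    exact Finset.sum_nonneg fun k _ => mul_nonneg (norm_nonneg _) (by linarith [hpn k]), ?_⟩
  intro m₁ m₂ x lam
  have hp0 : 0 < p := by linarith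
  set S := ⨆ q : {q : Y → 𝕜 // IsHomogPoly 𝕜 n q ∧ polyNorm q ≤ 1},
        (∑ j, ‖∑ i, lam j i • q.1 (x j i)‖ ^ p) ^ (1 / p) with hS
  have key : ∀ k, (∑ j, ‖∑ i, lam j i • q k (x j i)‖ ^ p) ^ (1 / p) ≤ (polyNorm (q k) + 1) * S := by
    intro k
    have hr : 0 < polyNorm (q k) + 1 := by linarith [hpn k]
    set r := polyNorm (q k) + 1 with hrdef
    let q' : Y → 𝕜 := fun y => ((r⁻¹ : ℝ) : 𝕜) • q k y
    have hq' : IsHomogPoly 𝕜 n q' := by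
      obtain ⟨U, hU⟩ := hq k
      exact ⟨((r⁻¹ : ℝ) : 𝕜) • U, fun y => by simp [q', hU]⟩
    have hq'1 : polyNorm q' ≤ 1 := by
      refine Real.iSup_le (fun y => ?_) zero_le_one
      simp only [q', norm_smul, RCLike.norm_ofReal, abs_inv, abs_of_pos hr]
      rw [inv_mul_eq_div, div_le_one hr]
      exact (le_ciSup (poly_bddAbove (hq k)) y).trans (by change polyNorm (q k) ≤ r; linarith)
    have h1 := le_ciSup (poly_sup_bdd (n := n) hp x lam) ⟨q', hq', hq'1⟩
    rw [← hS] at h1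
    refine le_trans (le_of_eq ?_) (mul_le_mul_of_nonneg_left h1 hr.le)
    have h2 : ∀ j, ‖∑ i, lam j i • q' (x j i)‖ = r⁻¹ * ‖∑ i, lam j i • q k (x j i)‖ := by
      intro j
      have : ∑ i, lam j i • q' (x j i) = ((r⁻¹ : ℝ) : 𝕜) • ∑ i, lam j i • q k (x j i) := by
        rw [Finset.smul_sum]
        exact Finset.sum_congr rfl fun i _ => smul_comm _ _ _
      rw [this, norm_smul, RCLike.norm_ofReal, abs_inv, abs_of_pos hr]
    simp only [h2]
    simp_rw [Real.mul_rpow (inv_nonneg.2 hr.le) (norm_nonneg _)]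
    rw [← Finset.mul_sum, Real.mul_rpow (by positivity) (by positivity), ← Real.rpow_mul (by positivity),
      mul_one_div_cancel hp0.ne', Real.rpow_one, ← mul_assoc, mul_inv_cancel₀ hr.ne', one_mul]
  calc (∑ j, ‖∑ i, lam j i • P (x j i)‖ ^ p) ^ (1 / p)
      ≤ (∑ j, (∑ k, ‖b k‖ * ‖∑ i, lam j i • q k (x j i)‖) ^ p) ^ (1 / p) := by
        gcongr with j _
        have : ∑ i, lam j i • P (x j i) = ∑ k, (∑ i, lam j i • q k (x j i)) • b k := by
          simp_rw [hPq, Finset.smul_sum, Finset.sum_smul]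
          rw [Finset.sum_comm]
          simp only [smul_smul, smul_eq_mul]
        rw [this]
        refine (norm_sum_le _ _).trans (Finset.sum_le_sum fun k _ => ?_)
        rw [norm_smul, mul_comm]
    _ ≤ ∑ k, (∑ j, (‖b k‖ * ‖∑ i, lam j i • q k (x j i)‖) ^ p) ^ (1 / p) :=
        minkowski_sum _ _ hp (fun k j => ‖b k‖ * ‖∑ i, lam j i • q k (x j i)‖)
          (fun k j => by positivity)
    _ ≤ ∑ k, ‖b k‖ * ((polyNorm (q k) + 1) * S) := by
        refine Finset.sum_le_sum fun k _ => ?_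
        simp_rw [Real.mul_rpow (norm_nonneg _) (norm_nonneg _)]
        rw [← Finset.mul_sum, Real.mul_rpow (by positivity) (by positivity),
          ← Real.rpow_mul (by positivity), mul_one_div_cancel hp0.ne', Real.rpow_one]
        exact mul_le_mul_of_nonneg_left (key k) (norm_nonneg _)
    _ = (∑ k, ‖b k‖ * (polyNorm (q k) + 1)) * S := by
        rw [Finset.sum_mul]
        exact Finset.sum_congr rfl fun k _ => by ring

/-- Extraction of the linear part of a polynomial at a point. -/
theorem linear_part {𝕜 X Y : Type*} [RCLike 𝕜] [NormedAddCommGroup X] [NormedSpace 𝕜 X]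
    [NormedAddCommGroup Y] [NormedSpace 𝕜 Y] {n : ℕ} {lam t : Fin (n + 1) → 𝕜}
    (h : ∀ k ≤ n, ∑ i, lam i * t i ^ k = if k = 1 then 1 else 0) {q : X → Y}
    (hq : IsHomogPoly 𝕜 n q) (y0 : X) :
    ∃ f : X →ₗ[𝕜] Y, ∀ x, f x = ∑ i, lam i • q (y0 + t i • x) := by
  classical
  obtain ⟨T, hT⟩ := hq
  refine ⟨∑ k, T.toMultilinearMap.toLinearMap (fun _ => y0) k, fun x => ?_⟩
  have hexp : ∀ i, q (y0 + t i • x) =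
      ∑ s : Finset (Fin n), t i ^ s.card • T (s.piecewise (fun _ => x) (fun _ => y0)) := by
    intro i
    rw [hT]
    have h1 := T.toMultilinearMap.map_add_univ (fun _ => t i • x) (fun _ => y0)
    have h2 : (fun _ : Fin n => y0 + t i • x) = (fun _ => t i • x) + (fun _ => y0) := by
      ext; simp [add_comm]
    rw [h2]
    refine h1.trans (Finset.sum_congr rfl fun s _ => ?_)
    have h3 := T.toMultilinearMap.map_piecewise_smul (fun _ => t i)
      (s.piecewise (fun _ => x) (fun _ => y0)) s
    rw [Finset.prod_const] at h3
    refine Eq.trans ?_ h3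
    congr 1
    ext j
    by_cases hj : j ∈ s <;> simp [hj]
  simp_rw [hexp, Finset.smul_sum]
  rw [Finset.sum_comm]
  simp_rw [smul_smul, ← Finset.sum_smul]
  have hc : ∀ s : Finset (Fin n), ∑ i, lam i * t i ^ s.card = if s.card = 1 then 1 else 0 :=
    fun s => h _ (by simpa using s.card_le_univ)
  simp_rw [hc, ite_smul, one_smul, zero_smul]
  rw [← Finset.sum_filter]
  have himg : (Finset.univ.filter fun s : Finset (Fin n) => s.card = 1) =
      Finset.univ.image (fun k : Fin n => ({k} : Finset (Fin n))) := by
    ext s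
    simp [Finset.card_eq_one, eq_comm]
  rw [himg, Finset.sum_image (fun a _ b _ hab => Finset.singleton_injective hab)]
  simp only [LinearMap.sum_apply]
  refine Finset.sum_congr rfl fun k _ => ?_
  rw [Finset.piecewise_singleton]
  rfl

theorem infinite_dim_direction {𝕜 : Type*} [RCLike 𝕜] (Y : Type*)
    [NormedAddCommGroup Y] [NormedSpace 𝕜 Y]
    (n : ℕ) (hn : 0 < n) (p : ℝ) (hp : 1 ≤ p)
    (hall : ∀ P : Y → Y, IsHomogPoly 𝕜 n P → FactStronglySummingPoly 𝕜 n p P) :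
    FiniteDimensional 𝕜 Y := by
  classical
  by_contra hinf
  have hp0 : 0 < p := by linarith
  obtain ⟨y1, hy1⟩ : ∃ y : Y, y ≠ 0 := by
    by_contra hc
    push Not at hc
    have : Subsingleton Y := ⟨fun a b => by rw [hc a, hc b]⟩
    exact hinf inferInstance
  have hy1n : ‖y1‖ ≠ 0 := norm_ne_zero_iff.2 hy1
  obtain ⟨φ, -, hφ⟩ := exists_dual_vector 𝕜 y1 hy1n
  let y0 : Y := ((‖y1‖⁻¹ : ℝ) : 𝕜) • y1
  have hy0 : φ y0 = 1 := by
    simp only [y0, map_smul, hφ, smul_eq_mul, ← RCLike.ofReal_mul, inv_mul_cancel₀ hy1n,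
      RCLike.ofReal_one]
  let K : Submodule 𝕜 Y := LinearMap.ker (φ : Y →ₗ[𝕜] 𝕜)
  have hK : ¬ FiniteDimensional 𝕜 K := by
    intro hfin
    have : Module.Finite 𝕜 (Y ⧸ K) :=
      Module.Finite.equiv (LinearMap.quotKerEquivRange (φ : Y →ₗ[𝕜] 𝕜)).symm
    exact hinf (Module.Finite.of_submodule_quotient K)
  obtain ⟨m, rfl⟩ : ∃ m, n = m + 1 := ⟨n - 1, by omega⟩
  let P : Y → Y := fun y => φ y ^ m • y
  have hP : IsHomogPoly 𝕜 (m + 1) P := by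
    let Φ : ContinuousMultilinearMap 𝕜 (fun _ : Fin m => Y) 𝕜 :=
      (ContinuousMultilinearMap.mkPiAlgebra 𝕜 (Fin m) 𝕜).compContinuousLinearMap (fun _ => φ)
    let Ψ : ContinuousMultilinearMap 𝕜 (fun _ : Fin m => Y) (Y →L[𝕜] Y) :=
      Φ.smulRight (ContinuousLinearMap.id 𝕜 Y)
    refine ⟨ContinuousMultilinearMap.uncurryRight (Ei := fun _ : Fin (m + 1) => Y) Ψ, fun y => ?_⟩
    rw [ContinuousMultilinearMap.uncurryRight_apply]
    simp [Ψ, Φ, P, Fin.init]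
  obtain ⟨-, C, hC0, hC⟩ := hall P hP
  obtain ⟨lam, t, hlt⟩ := interp_coeffs 𝕜 (m + 1)
  let B : ℝ := ∑ i, ‖lam i‖ * (‖y0‖ + ‖t i‖ + 1) ^ (m + 1)
  have hB : 0 ≤ B := Finset.sum_nonneg fun i _ => by positivity
  -- key bound
  have key : ∀ N : ℕ, (N : ℝ) / 2 ^ (p + 1) ≤ (C * (B + 1)) ^ p * √N := by
    intro N
    obtain ⟨z, A, hA, hAz, hz⟩ := dr_lemma hK N
    have h1 := hC N (m + 1 + 1) (fun j i => y0 + t i • (z j : Y)) (fun _ i => lam i)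
    have h2 : ∀ j, ∑ i, lam i • P (y0 + t i • (z j : Y)) = z j := by
      intro j
      have hzj : φ (z j : Y) = 0 := (z j).2
      simp only [P, map_add, map_smul, hzj, hy0, smul_zero, add_zero, one_pow, one_smul, smul_add, one_mul,
        Finset.sum_add_distrib, smul_smul]
      rw [← Finset.sum_smul, ← Finset.sum_smul]
      have e0 := hlt 0 (by omega)
      have e1 := hlt 1 (by omega)
      simp only [pow_zero, mul_one, pow_one, if_true] at e0 e1
      rw [e0, e1]
      simp
    simp only [h2] at h1
    have h3 : (⨆ q : {q : Y → 𝕜 // IsHomogPoly 𝕜 (m + 1) q ∧ polyNorm q ≤ 1},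
        (∑ j, ‖∑ i, lam i • q.1 (y0 + t i • (z j : Y))‖ ^ p) ^ (1 / p)) ≤
        (B + 1) * √N ^ (1 / p) := by
      refine Real.iSup_le ?_ (by positivity)
      rintro ⟨q, hq, hq1⟩
      simp only
      obtain ⟨f, hf⟩ := linear_part hlt hq y0
      simp_rw [← hf]
      have hfb : ∀ x, ‖x‖ ≤ 1 → ‖f x‖ ≤ B := by
        intro x hx
        rw [hf]
        refine (norm_sum_le _ _).trans (Finset.sum_le_sum fun i _ => ?_)
        rw [norm_smul]
        gcongr
        have hn1 : ‖y0 + t i • x‖ ≤ ‖y0‖ + ‖t i‖ + 1 := by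
          refine (norm_add_le _ _).trans ?_
          rw [norm_smul (t i) x]
          nlinarith [norm_nonneg (t i)]
        have := poly_bound hq (y0 + t i • x) (by positivity) hn1
        have h2 : 0 ≤ (‖y0‖ + ‖t i‖ + 1) ^ (m + 1) := by positivity
        nlinarith
      have hfb2 : ∀ x, ‖f x‖ ≤ B * ‖x‖ := by
        intro x
        by_cases hx : x = 0
        · simp [hx]
        have hxn : 0 < ‖x‖ := norm_pos_iff.2 hx
        have h4 := hfb (((‖x‖⁻¹ : ℝ) : 𝕜) • x) (by
          simp only [norm_smul, RCLike.norm_ofReal, abs_inv, abs_norm]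
          rw [inv_mul_cancel₀ hxn.ne'])
        simp only [map_smul, norm_smul, RCLike.norm_ofReal, abs_inv, abs_norm] at h4
        rwa [inv_mul_eq_div, div_le_iff₀ hxn] at h4
      let F : K →L[𝕜] 𝕜 := (f.mkContinuous B hfb2).comp K.subtypeL
      have hF : ‖F‖ ≤ B := by
        refine ContinuousLinearMap.opNorm_le_bound _ hB fun x => ?_
        exact hfb2 x
      have hsq : ∑ j, ‖f (z j : Y)‖ ^ 2 ≤ B ^ 2 :=
        (hz F).trans (pow_le_pow_left₀ (norm_nonneg _) hF 2)
      let a : Fin N → ℝ := fun j => ‖f (z j : Y)‖ / (B + 1)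
      have hB1 : 0 < B + 1 := by linarith
      have ha0 : ∀ j, 0 ≤ a j := fun j => by positivity
      have hasq : ∑ j, a j ^ 2 ≤ 1 := by
        simp only [a, div_pow]
        rw [← Finset.sum_div, div_le_one (by positivity)]
        nlinarith
      have ha1 : ∀ j, a j ≤ 1 := fun j => by
        have : a j ^ 2 ≤ 1 := (Finset.single_le_sum (f := fun j => a j ^ 2)
          (fun i _ => sq_nonneg _) (Finset.mem_univ j)).trans hasq
        nlinarith [ha0 j]
      have hsum : ∑ j, a j ≤ √N := by
        apply Real.le_sqrt_of_sq_le
        have := sq_sum_le_card_mul_sum_sq (s := Finset.univ) (f := a)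
        simp only [Finset.card_univ, Fintype.card_fin] at this
        have hN : (0:ℝ) ≤ N := Nat.cast_nonneg N
        nlinarith
      have hap : ∑ j, a j ^ p ≤ √N := by
        refine le_trans (Finset.sum_le_sum fun j _ => ?_) hsum
        calc a j ^ p ≤ a j ^ (1 : ℝ) := Real.rpow_le_rpow_of_exponent_ge' (ha0 j) (ha1 j) zero_le_one hp
          _ = a j := Real.rpow_one _
      have hfa : ∀ j, ‖f (z j : Y)‖ = (B + 1) * a j := fun j => by
        simp only [a]; field_simp
      simp_rw [hfa, Real.mul_rpow hB1.le (ha0 _)]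
      rw [← Finset.mul_sum, Real.mul_rpow (by positivity)
        (Finset.sum_nonneg fun j _ => Real.rpow_nonneg (ha0 j) _), ← Real.rpow_mul hB1.le,
        mul_one_div_cancel hp0.ne', Real.rpow_one]
      gcongr
    have h4 : (N : ℝ) / 2 ^ (p + 1) ≤ ∑ j, ‖(z j : Y)‖ ^ p := by
      calc (N : ℝ) / 2 ^ (p + 1) ≤ (2 * A.card : ℝ) / 2 ^ (p + 1) := by
            gcongr; exact_mod_cast hA
        _ = ∑ j ∈ A, (1 / 2 : ℝ) ^ p := by
            rw [Finset.sum_const, nsmul_eq_mul, Real.rpow_add (by norm_num), Real.rpow_one,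
              Real.div_rpow (by norm_num) (by norm_num), Real.one_rpow]
            field_simp
        _ ≤ ∑ j ∈ A, ‖(z j : Y)‖ ^ p :=
            Finset.sum_le_sum fun j hj => Real.rpow_le_rpow (by norm_num) (hAz j hj) hp0.le
        _ ≤ ∑ j, ‖(z j : Y)‖ ^ p :=
            Finset.sum_le_sum_of_subset_of_nonneg (Finset.subset_univ _) fun j _ _ => by positivity
    have h5 : (∑ j, ‖(z j : Y)‖ ^ p) ^ (1 / p) ≤ C * ((B + 1) * √N ^ (1 / p)) :=
      h1.trans (mul_le_mul_of_nonneg_left h3 hC0)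
    have h6 := Real.rpow_le_rpow (by positivity) h5 hp0.le
    rw [← Real.rpow_mul (Finset.sum_nonneg fun j _ => by positivity),
      one_div_mul_cancel hp0.ne', Real.rpow_one, ← mul_assoc,
      Real.mul_rpow (by positivity) (by positivity), ← Real.rpow_mul (by positivity),
      one_div_mul_cancel hp0.ne', Real.rpow_one] at h6
    exact h4.trans h6
  obtain ⟨M, hM⟩ := exists_nat_gt ((C * (B + 1)) ^ p * 2 ^ (p + 1))
  have h7 := key (M ^ 2)
  have h2p : (0:ℝ) < 2 ^ (p + 1) := by positivity
  rw [Nat.cast_pow, Real.sqrt_sq (Nat.cast_nonneg M), div_le_iff₀ h2p] at h7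
  have hM0 : (0:ℝ) < M := lt_of_le_of_lt (by positivity) hM
  nlinarith

/-- Dvoretzky–Rogers type theorem for polynomials: every continuous
`n`-homogeneous polynomial `P : Y → Y` is factorable strongly `p`-summing iff `Y` is
finite-dimensional. -/
theorem dvoretzkyRogers_factStronglySummingPoly
    {𝕜 : Type*} [RCLike 𝕜] (Y : Type*)
    [NormedAddCommGroup Y] [NormedSpace 𝕜 Y] [CompleteSpace Y]
    (n : ℕ) (hn : 0 < n) (p : ℝ) (hp : 1 ≤ p) :
    (∀ P : Y → Y, IsHomogPoly 𝕜 n P → FactStronglySummingPoly 𝕜 n p P) ↔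
      FiniteDimensional 𝕜 Y := by
  constructor
  · exact infinite_dim_direction Y n hn p hp
  · intro h P hP
    exact finite_dim_direction Y n p hp P hP
end
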